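/- arXiv:1705.07068 — 3 statements merged into one kernel-verified Lean document; each statement's English description precedes it below -/
import Mathlib

section
/- There exist constants 0 < c ≤ C such that for all θ, θ' ∈ [−π/2, π/2] and all φ, φ' ∈ ℝ, c Φ ≤ ϱ(⟨θ,φ⟩, ⟨θ',φ'⟩) ≤ C Φ, where Φ = |θ − θ'| + min{ d_T(φ,φ')^{1/2}, d_T(φ,φ')/max{|tan θ|, |tan θ'|} }, d_T(φ,φ') denotes the arclength distance on ℝ/2πℤ between the classes of φ and φ', and the second term of the min is interpreted as 0 when θ = ±π/2 or θ' = ±π/2. In particular ϱ(⟨0,φ⟩, ⟨0,φ'⟩) is comparable to d_T(φ,φ')^{1/2}. -/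
open MeasureTheory Set
open scoped ENNReal NNReal

noncomputable section

/-- Euclidean `ℝ³`. -/
abbrev E3 : Type := EuclideanSpace ℝ (Fin 3)

/-- The point `⟨θ,φ⟩ = (cosθ cosφ, cosθ sinφ, sinθ)` of the unit sphere. -/
def spt (θ φ : ℝ) : E3 :=
  (WithLp.equiv 2 (Fin 3 → ℝ)).symm
    ![Real.cos θ * Real.cos φ, Real.cos θ * Real.sin φ, Real.sin θ]

/-- The vector field `Z₁ = z₃ ∂_{z₂} − z₂ ∂_{z₃}`. -/
def Z1 (z : E3) : E3 := (WithLp.equiv 2 (Fin 3 → ℝ)).symm ![0, z 2, -(z 1)]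

/-- The vector field `Z₂ = z₁ ∂_{z₃} − z₃ ∂_{z₁}`. -/
def Z2 (z : E3) : E3 := (WithLp.equiv 2 (Fin 3 → ℝ)).symm ![-(z 2), 0, z 0]

/-- `γ : [0,1] → S²` is a horizontal curve with (a.e.) derivative `a Z₁(γ) + b Z₂(γ)`:
equivalently (absolute continuity), `γ` is given by integrating `a Z₁(γ) + b Z₂(γ)`. -/
def IsHoriz (γ : ℝ → E3) (a b : ℝ → ℝ) : Prop :=
  ContinuousOn γ (Set.Icc 0 1) ∧
  IntegrableOn a (Set.Icc 0 1) ∧ IntegrableOn b (Set.Icc 0 1) ∧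
  (∀ t ∈ Set.Icc (0:ℝ) 1, γ t ∈ Metric.sphere (0 : E3) 1) ∧
  (∀ t ∈ Set.Icc (0:ℝ) 1,
    γ t = γ 0 + ∫ s in Set.Ioc (0:ℝ) t, (a s • Z1 (γ s) + b s • Z2 (γ s)))

/-- The sub-Riemannian (Carnot–Carathéodory) distance on the Grushin sphere: the infimum
of `∫₀¹ √(a(t)² + b(t)²) dt` over horizontal curves joining `z` to `z'` (with the infimum
also taken over all representations `(a,b)`); `∞` if there is no such curve. -/
def ccDist (z z' : E3) : ℝ≥0∞ :=
  ⨅ (γ : ℝ → E3) (a : ℝ → ℝ) (b : ℝ → ℝ) (_ : IsHoriz γ a b) (_ : γ 0 = z) (_ : γ 1 = z'),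
    ∫⁻ t in Set.Icc (0:ℝ) 1, ENNReal.ofReal (Real.sqrt (a t ^ 2 + b t ^ 2))

/-- The arclength distance on `ℝ/2πℤ` between the classes of `φ` and `φ'`. -/
def torusDist (φ φ' : ℝ) : ℝ := ⨅ k : ℤ, |φ - φ' + 2 * Real.pi * k|

/-- The comparison quantity
`Φ = |θ − θ'| + min{ d_T(φ,φ')^{1/2}, d_T(φ,φ')/max{|tanθ|,|tanθ'|} }`,
where the second term of the min is interpreted as `0` when `θ = ±π/2` or `θ' = ±π/2`
(and as `+∞`, i.e. the min is the first term, when `max{|tanθ|,|tanθ'|} = 0`). -/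
def PhiD (θ φ θ' φ' : ℝ) : ℝ :=
  |θ - θ'| +
    (if |θ| = Real.pi/2 ∨ |θ'| = Real.pi/2 then 0
     else if max |Real.tan θ| |Real.tan θ'| = 0 then Real.sqrt (torusDist φ φ')
     else min (Real.sqrt (torusDist φ φ'))
       (torusDist φ φ' / max |Real.tan θ| |Real.tan θ'|))

@[simp] theorem spt_zero (θ φ : ℝ) : spt θ φ 0 = Real.cos θ * Real.cos φ := rfl
@[simp] theorem spt_one (θ φ : ℝ) : spt θ φ 1 = Real.cos θ * Real.sin φ := rfl
@[simp] theorem spt_two (θ φ : ℝ) : spt θ φ 2 = Real.sin θ := rfl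
@[simp] theorem Z1_zero (z : E3) : Z1 z 0 = 0 := rfl
@[simp] theorem Z1_one (z : E3) : Z1 z 1 = z 2 := rfl
@[simp] theorem Z1_two (z : E3) : Z1 z 2 = -z 1 := rfl
@[simp] theorem Z2_zero (z : E3) : Z2 z 0 = -z 2 := rfl
@[simp] theorem Z2_one (z : E3) : Z2 z 1 = 0 := rfl
@[simp] theorem Z2_two (z : E3) : Z2 z 2 = z 0 := rfl

theorem continuous_Z1 : Continuous Z1 := by
  unfold Z1
  refine (PiLp.continuous_toLp 2 _).comp (continuous_pi fun i => ?_)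
  fin_cases i <;> simp <;> fun_prop

theorem continuous_Z2 : Continuous Z2 := by
  unfold Z2
  refine (PiLp.continuous_toLp 2 _).comp (continuous_pi fun i => ?_)
  fin_cases i <;> simp <;> fun_prop

theorem mem_sphere_E3 {z : E3} :
    z ∈ Metric.sphere (0 : E3) 1 ↔ z 0 ^ 2 + z 1 ^ 2 + z 2 ^ 2 = 1 := by
  rw [mem_sphere_zero_iff_norm, ← sq_eq_sq₀ (norm_nonneg z) zero_le_one, EuclideanSpace.norm_sq_eq,
    Fin.sum_univ_three]
  simp

theorem spt_mem_sphere (θ φ : ℝ) : spt θ φ ∈ Metric.sphere (0 : E3) 1 := by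
  rw [mem_sphere_E3, spt_zero, spt_one, spt_two]
  linear_combination Real.cos θ ^ 2 * Real.sin_sq_add_cos_sq φ + Real.sin_sq_add_cos_sq θ

/-- The velocity of a horizontal curve `γ` with controls `a`, `b`. -/
def horizVel (γ : ℝ → E3) (a b : ℝ → ℝ) (s : ℝ) : E3 := a s • Z1 (γ s) + b s • Z2 (γ s)

/-- The speed of a horizontal curve with controls `a`, `b`. -/
def horizSpeed (a b : ℝ → ℝ) (s : ℝ) : ℝ := √(a s ^ 2 + b s ^ 2)

theorem horizSpeed_nonneg (a b : ℝ → ℝ) (s : ℝ) : 0 ≤ horizSpeed a b s := Real.sqrt_nonneg _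

theorem integrableOn_horizVel {γ : ℝ → E3} {a b : ℝ → ℝ} (hγ : ContinuousOn γ (Icc 0 1))
    (ha : IntegrableOn a (Icc 0 1)) (hb : IntegrableOn b (Icc 0 1)) :
    IntegrableOn (horizVel γ a b) (Icc 0 1) :=
  (ha.smul_continuousOn (continuous_Z1.comp_continuousOn hγ) isCompact_Icc).add
    (hb.smul_continuousOn (continuous_Z2.comp_continuousOn hγ) isCompact_Icc)

theorem integrableOn_horizSpeed {a b : ℝ → ℝ} {s : Set ℝ}
    (ha : IntegrableOn a s) (hb : IntegrableOn b s) : IntegrableOn (horizSpeed a b) s := by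
  refine Integrable.mono' (ha.norm.add hb.norm) ?_ (Filter.Eventually.of_forall fun t => ?_)
  · exact (Real.continuous_sqrt.comp_aestronglyMeasurable
      ((ha.aestronglyMeasurable.pow 2).add (hb.aestronglyMeasurable.pow 2)))
  · rw [Real.norm_of_nonneg (horizSpeed_nonneg a b t), horizSpeed]
    simp only [Pi.add_apply, Real.norm_eq_abs]
    rw [Real.sqrt_le_left (by positivity)]
    nlinarith [sq_abs (a t), sq_abs (b t), abs_nonneg (a t), abs_nonneg (b t),
      mul_nonneg (abs_nonneg (a t)) (abs_nonneg (b t))]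

theorem lintegral_horizSpeed {a b : ℝ → ℝ} (ha : IntegrableOn a (Icc 0 1))
    (hb : IntegrableOn b (Icc 0 1)) :
    ∫⁻ t in Icc (0:ℝ) 1, ENNReal.ofReal (√(a t ^ 2 + b t ^ 2))
      = ENNReal.ofReal (∫ t in (0:ℝ)..1, horizSpeed a b t) := by
  rw [intervalIntegral.integral_of_le zero_le_one, ← integral_Icc_eq_integral_Ioc,
    ofReal_integral_eq_lintegral_ofReal (integrableOn_horizSpeed ha hb)
      (Filter.Eventually.of_forall fun t => horizSpeed_nonneg a b t)]
  rfl

/-- The orthogonal projection of `ℝ³` to the horizontal plane, identified with `ℂ`. -/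
def planeProj : E3 →L[ℝ] ℂ :=
  (EuclideanSpace.proj (𝕜 := ℝ) (0 : Fin 3)).smulRight (1 : ℂ) +
    (EuclideanSpace.proj (𝕜 := ℝ) (1 : Fin 3)).smulRight Complex.I

theorem planeProj_apply (z : E3) : planeProj z = ⟨z 0, z 1⟩ := by
  apply Complex.ext <;> simp [planeProj]

theorem planeProj_spt (θ φ : ℝ) :
    planeProj (spt θ φ) = Real.cos θ * Complex.exp (Complex.I * φ) := by
  rw [planeProj_apply, mul_comm Complex.I, Complex.exp_mul_I, ← Complex.ofReal_cos,
    ← Complex.ofReal_sin]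
  apply Complex.ext <;> simp [-Complex.ofReal_cos, -Complex.ofReal_sin]

theorem norm_planeProj_vel (γ : ℝ → E3) (a b : ℝ → ℝ) (s : ℝ) :
    ‖planeProj (horizVel γ a b s)‖ = |γ s 2| * horizSpeed a b s := by
  rw [planeProj_apply, Complex.norm_def, Complex.normSq_mk, horizSpeed, ← Real.sqrt_sq_eq_abs,
    ← Real.sqrt_mul (sq_nonneg _)]
  simp [horizVel]
  congr 1
  ring

theorem abs_vel_two_le {γ : ℝ → E3} {a b : ℝ → ℝ} {s : ℝ}
    (h : γ s ∈ Metric.sphere (0 : E3) 1) :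
    |horizVel γ a b s 2| ≤ horizSpeed a b s := by
  rw [mem_sphere_E3] at h
  rw [horizSpeed]
  apply Real.abs_le_sqrt
  simp only [horizVel, PiLp.add_apply, PiLp.smul_apply, Z1_two, Z2_two, smul_eq_mul]
  nlinarith [sq_nonneg (a s * γ s 0 + b s * γ s 1), mul_nonneg (add_nonneg (sq_nonneg (a s))
    (sq_nonneg (b s))) (sq_nonneg (γ s 2))]

theorem abs_apply_two_le {z : E3} (h : z ∈ Metric.sphere (0 : E3) 1) : |z 2| ≤ 1 := by
  rw [mem_sphere_E3] at h
  rw [← sq_le_one_iff_abs_le_one]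
  nlinarith [sq_nonneg (z 0), sq_nonneg (z 1)]

namespace IsHoriz

variable {γ : ℝ → E3} {a b : ℝ → ℝ}

/-- A linear functional changes along a horizontal curve by at most the length times a bound for
its speed. -/
theorem norm_map_sub_le {F : Type*} [NormedAddCommGroup F] [NormedSpace ℝ F] [CompleteSpace F]
    (h : IsHoriz γ a b) (A : E3 →L[ℝ] F) {M : ℝ} (hM : 0 ≤ M)
    (hA : ∀ s ∈ Icc (0:ℝ) 1, ‖A (horizVel γ a b s)‖ ≤ M * horizSpeed a b s)
    {t : ℝ} (ht : t ∈ Icc (0:ℝ) 1) :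
    ‖A (γ t) - A (γ 0)‖ ≤ M * ∫ s in (0:ℝ)..1, horizSpeed a b s := by
  obtain ⟨hc, ha, hb, -, hγ⟩ := h
  have hsub : Ioc (0:ℝ) t ⊆ Icc 0 1 := fun s hs => ⟨hs.1.le, hs.2.trans ht.2⟩
  have hsp := integrableOn_horizSpeed ha hb
  have hv := (integrableOn_horizVel hc ha hb).mono_set hsub
  have e : A (γ t) - A (γ 0) = ∫ s in Ioc (0:ℝ) t, A (horizVel γ a b s) := by
    rw [A.integral_comp_comm hv, hγ t ht, map_add, add_sub_cancel_left]
    rfl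
  rw [e, intervalIntegral.integral_of_le zero_le_one]
  calc ‖∫ s in Ioc (0:ℝ) t, A (horizVel γ a b s)‖
      ≤ ∫ s in Ioc (0:ℝ) t, M * horizSpeed a b s := by
        refine norm_integral_le_of_norm_le ((hsp.mono_set hsub).const_mul M) ?_
        exact (ae_restrict_mem measurableSet_Ioc).mono fun s hs => hA s (hsub hs)
    _ = M * ∫ s in Ioc (0:ℝ) t, horizSpeed a b s := integral_const_mul _ _
    _ ≤ _ := by
        refine mul_le_mul_of_nonneg_left ?_ hM
        refine setIntegral_mono_set (hsp.mono_set Ioc_subset_Icc_self)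
          (Filter.Eventually.of_forall fun s => horizSpeed_nonneg a b s) ?_
        exact (Ioc_subset_Ioc_right ht.2).eventuallyLE

theorem abs_height_sub_le (h : IsHoriz γ a b) {t : ℝ} (ht : t ∈ Icc (0:ℝ) 1) :
    |γ t 2 - γ 0 2| ≤ ∫ s in (0:ℝ)..1, horizSpeed a b s := by
  simpa using h.norm_map_sub_le (EuclideanSpace.proj (𝕜 := ℝ) (2 : Fin 3)) zero_le_one
    (fun s hs => by simpa using abs_vel_two_le (h.2.2.2.1 s hs)) ht

theorem norm_planeProj_sub_le (h : IsHoriz γ a b) :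
    ‖planeProj (γ 1) - planeProj (γ 0)‖ ≤ ∫ s in (0:ℝ)..1, horizSpeed a b s := by
  simpa using h.norm_map_sub_le planeProj zero_le_one (fun s hs => by
    rw [norm_planeProj_vel]
    exact mul_le_mul_of_nonneg_right (abs_apply_two_le (h.2.2.2.1 s hs)) (horizSpeed_nonneg a b s))
    (right_mem_Icc.2 zero_le_one)

theorem norm_planeProj_sub_le' (h : IsHoriz γ a b) :
    ‖planeProj (γ 1) - planeProj (γ 0)‖ ≤
      (|γ 0 2| + ∫ s in (0:ℝ)..1, horizSpeed a b s) * ∫ s in (0:ℝ)..1, horizSpeed a b s := by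
  refine h.norm_map_sub_le planeProj ?_ (fun s hs => ?_) (right_mem_Icc.2 zero_le_one)
  · exact add_nonneg (abs_nonneg _)
      (intervalIntegral.integral_nonneg zero_le_one fun s _ => horizSpeed_nonneg a b s)
  · rw [norm_planeProj_vel]
    refine mul_le_mul_of_nonneg_right ?_ (horizSpeed_nonneg a b s)
    have := h.abs_height_sub_le hs
    linarith [abs_sub_abs_le_abs_sub (γ s 2) (γ 0 2)]

end IsHoriz

theorem two_div_pi_mul_abs_le_abs_sin {x : ℝ} (hx : |x| ≤ Real.pi) :
    |x| ≤ Real.pi * |Real.sin (x / 2)| := by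
  have h := Real.mul_abs_le_abs_sin (x := x / 2) (by rw [abs_div, abs_two]; linarith)
  rw [abs_div, abs_two] at h
  have := Real.pi_pos
  calc |x| = Real.pi * (2 / Real.pi * (|x| / 2)) := by field_simp
    _ ≤ _ := by gcongr

theorem exists_torusDist_eq (φ φ' : ℝ) :
    ∃ k : ℤ, torusDist φ φ' = |φ - φ' + 2 * Real.pi * k| ∧
      |φ - φ' + 2 * Real.pi * k| ≤ Real.pi := by
  have hp : (0:ℝ) < 2 * Real.pi := by positivity
  set x := (φ - φ') / (2 * Real.pi) with hx
  have key : ∀ k : ℤ, |φ - φ' + 2 * Real.pi * k| = 2 * Real.pi * |x - (-k : ℤ)| := fun k => by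
    rw [← abs_of_pos hp, ← abs_mul, abs_of_pos hp, hx]
    congr 1
    push_cast
    field_simp
    ring
  refine ⟨-round x, le_antisymm (ciInf_le ⟨0, ?_⟩ _) (le_ciInf fun k => ?_), ?_⟩
  · rintro _ ⟨k, rfl⟩
    exact abs_nonneg _
  · rw [key, key, neg_neg]
    exact mul_le_mul_of_nonneg_left (round_le x _) hp.le
  · rw [key, neg_neg]
    nlinarith [abs_sub_round x]

theorem torusDist_nonneg (φ φ' : ℝ) : 0 ≤ torusDist φ φ' := Real.iInf_nonneg fun _ => abs_nonneg _

theorem torusDist_le_pi (φ φ' : ℝ) : torusDist φ φ' ≤ Real.pi := by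
  obtain ⟨k, h, h'⟩ := exists_torusDist_eq φ φ'
  exact h ▸ h'

theorem torusDist_le_chord (φ φ' : ℝ) : torusDist φ φ' ≤
    Real.pi / 2 * ‖Complex.exp (Complex.I * φ) - Complex.exp (Complex.I * φ')‖ := by
  obtain ⟨k, h, h'⟩ := exists_torusDist_eq φ φ'
  have e : Complex.exp (Complex.I * φ) - Complex.exp (Complex.I * φ')
      = Complex.exp (Complex.I * φ') *
        (Complex.exp (Complex.I * (φ - φ' + 2 * Real.pi * k : ℝ)) - 1) := by
    rw [mul_sub, ← Complex.exp_add, mul_one]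
    congr 1
    rw [← Complex.exp_periodic.int_mul k]
    push_cast
    ring_nf
  rw [e, norm_mul, Complex.norm_exp_I_mul_ofReal, one_mul, Complex.norm_exp_I_mul_ofReal_sub_one, h,
    Real.norm_eq_abs, abs_mul, abs_two]
  linarith [two_div_pi_mul_abs_le_abs_sin h']

theorem abs_sub_le_chord {θ θ' L : ℝ} (h : |θ - θ'| ≤ Real.pi)
    (hc : |Real.cos θ - Real.cos θ'| ≤ L) (hs : |Real.sin θ - Real.sin θ'| ≤ L) :
    |θ - θ'| ≤ Real.pi * L := by
  refine (two_div_pi_mul_abs_le_abs_sin h).trans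
    (mul_le_mul_of_nonneg_left ?_ Real.pi_pos.le)
  have hL : 0 ≤ L := (abs_nonneg _).trans hc
  refine abs_le_of_sq_le_sq ?_ hL
  have e : 4 * Real.sin ((θ - θ') / 2) ^ 2
      = (Real.cos θ - Real.cos θ') ^ 2 + (Real.sin θ - Real.sin θ') ^ 2 := by
    rw [Real.cos_sub_cos, Real.sin_sub_sin]
    linear_combination -4 * Real.sin ((θ - θ') / 2) ^ 2 *
      Real.sin_sq_add_cos_sq ((θ + θ') / 2)
  have h1 := sq_le_sq' (abs_le.1 hc).1 (abs_le.1 hc).2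
  have h2 := sq_le_sq' (abs_le.1 hs).1 (abs_le.1 hs).2
  nlinarith [sq_nonneg L]

/-- Projecting one of two points of the plane radially to the circle through the other one at most
doubles their distance. -/
theorem mul_norm_sub_le {r r' : ℝ} (hr : 0 ≤ r) (hr' : 0 ≤ r') {u v : ℂ} (hu : ‖u‖ = 1)
    (hv : ‖v‖ = 1) : max r r' * ‖u - v‖ ≤ 2 * ‖r * u - r' * v‖ := by
  have hd : |r - r'| ≤ ‖(r * u - r' * v : ℂ)‖ := by
    have := abs_norm_sub_norm_le (r * u : ℂ) (r' * v)
    simpa [hu, hv, abs_of_nonneg hr, abs_of_nonneg hr'] using this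
  rcases max_cases r r' with ⟨h, -⟩ | ⟨h, -⟩ <;> rw [h]
  · have e : (r : ℂ) * (u - v) = (r * u - r' * v) - ((r - r' : ℝ) : ℂ) * v := by push_cast; ring
    have := norm_sub_le (r * u - r' * v : ℂ) (((r - r' : ℝ) : ℂ) * v)
    rw [← e, norm_mul, norm_mul, hv, Complex.norm_real, Complex.norm_real, Real.norm_of_nonneg hr,
      Real.norm_eq_abs] at this
    linarith
  · have e : (r' : ℂ) * (u - v) = (r * u - r' * v) - ((r - r' : ℝ) : ℂ) * u := by push_cast; ring
    have := norm_sub_le (r * u - r' * v : ℂ) (((r - r' : ℝ) : ℂ) * u)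
    rw [← e, norm_mul, norm_mul, hu, Complex.norm_real, Complex.norm_real, Real.norm_of_nonneg hr',
      Real.norm_eq_abs] at this
    linarith

/-- The angular part of the comparison quantity is controlled by any `L` that dominates the
displacement of the horizontal projection. -/
theorem angular_le {θ θ' d L : ℝ} (hθ : 0 < Real.cos θ) (hθ' : 0 < Real.cos θ') (hd : 0 ≤ d)
    (hdπ : d ≤ Real.pi) (hL : 0 ≤ L)
    (h : max (Real.cos θ) (Real.cos θ') * d ≤
      Real.pi * ((max |Real.sin θ| |Real.sin θ'| + L) * L)) :
    (if max |Real.tan θ| |Real.tan θ'| = 0 then √d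
      else min √d (d / max |Real.tan θ| |Real.tan θ'|)) ≤ 7 * L := by
  have hπ := Real.pi_lt_d2
  have hπ0 := Real.pi_pos
  set R := max (Real.cos θ) (Real.cos θ') with hR
  set s := max |Real.sin θ| |Real.sin θ'| with hs
  set τ := max |Real.tan θ| |Real.tan θ'| with hτ
  obtain ⟨ρ, hρ, hρR, hsρ, hρτ⟩ : ∃ ρ, 0 < ρ ∧ ρ ≤ R ∧ s ^ 2 + ρ ^ 2 = 1 ∧ s ≤ ρ * τ := by
    have aux : ∀ x, 0 < Real.cos x → |Real.tan x| ≤ τ → |Real.sin x| ≤ Real.cos x * τ := by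
      intro x hx hxτ
      calc |Real.sin x| = Real.cos x * |Real.tan x| := by
            rw [← Real.tan_mul_cos hx.ne', abs_mul, abs_of_pos hx, mul_comm]
        _ ≤ _ := by gcongr
    rcases max_cases |Real.sin θ| |Real.sin θ'| with ⟨e, -⟩ | ⟨e, -⟩
    · refine ⟨Real.cos θ, hθ, le_max_left _ _, ?_, ?_⟩ <;> rw [hs, e]
      · rw [sq_abs, Real.sin_sq_add_cos_sq]
      · exact aux θ hθ (le_max_left _ _)
    · refine ⟨Real.cos θ', hθ', le_max_right _ _, ?_, ?_⟩ <;> rw [hs, e]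
      · rw [sq_abs, Real.sin_sq_add_cos_sq]
      · exact aux θ' hθ' (le_max_right _ _)
  have hs0 : 0 ≤ s := (abs_nonneg _).trans (le_max_left _ _)
  have hτ0 : 0 ≤ τ := (abs_nonneg _).trans (le_max_left _ _)
  rcases lt_or_ge L s with hLs | hLs
  · have hτ' : 0 < τ := by
      rcases hτ0.eq_or_lt with h0 | h0
      · rw [← h0] at hρτ; nlinarith
      · exact h0
    rw [if_neg hτ'.ne']
    refine (min_le_right _ _).trans ?_
    rw [div_le_iff₀ hτ']
    have h1 : ρ * d ≤ Real.pi * ((s + L) * L) := (mul_le_mul_of_nonneg_right hρR hd).trans h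
    have h2 : Real.pi * ((s + L) * L) ≤ 7 * (s * L) := by
      have h4 : (s + L) * L ≤ 2 * (s * L) := by nlinarith
      nlinarith [mul_nonneg hs0 hL]
    have h3 : s * L ≤ ρ * τ * L := mul_le_mul_of_nonneg_right hρτ hL
    exact le_of_mul_le_mul_left (by nlinarith : ρ * d ≤ ρ * (7 * L * τ)) hρ
  · have hsq : √d ≤ 7 * L := by
      rw [Real.sqrt_le_left (by positivity)]
      rcases le_total s (1 / 2) with h1 | h1
      · have hR' : 1 / 2 ≤ R := by nlinarith
        have h2 : Real.pi * ((s + L) * L) ≤ 7 * (L * L) := by nlinarith [mul_nonneg hs0 hL]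
        nlinarith
      · nlinarith
    split_ifs
    · exact hsq
    · exact (min_le_left _ _).trans hsq

theorem cos_pos_of_mem_Icc {θ : ℝ} (hθ : θ ∈ Icc (-(Real.pi / 2)) (Real.pi / 2))
    (h : |θ| ≠ Real.pi / 2) : 0 < Real.cos θ := by
  have h' := abs_lt.1 ((abs_le.2 hθ).lt_of_ne h)
  exact Real.cos_pos_of_mem_Ioo h'

theorem PhiD_le_of_isHoriz {γ : ℝ → E3} {a b : ℝ → ℝ} (h : IsHoriz γ a b) {θ θ' φ φ' : ℝ}
    (hθ : θ ∈ Icc (-(Real.pi / 2)) (Real.pi / 2)) (hθ' : θ' ∈ Icc (-(Real.pi / 2)) (Real.pi / 2))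
    (h0 : γ 0 = spt θ φ) (h1 : γ 1 = spt θ' φ') :
    PhiD θ φ θ' φ' ≤ 11 * ∫ s in (0:ℝ)..1, horizSpeed a b s := by
  have hz := h.abs_height_sub_le (right_mem_Icc.2 zero_le_one)
  have hp := h.norm_planeProj_sub_le
  have hp' := h.norm_planeProj_sub_le'
  set L := ∫ s in (0:ℝ)..1, horizSpeed a b s
  have hL : 0 ≤ L := (abs_nonneg _).trans hz
  rw [h0, h1, spt_two, spt_two] at hz
  rw [h0, h1, planeProj_spt, planeProj_spt, norm_sub_rev] at hp hp'
  rw [spt_two] at hp'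
  have hc := Real.cos_nonneg_of_mem_Icc hθ
  have hc' := Real.cos_nonneg_of_mem_Icc hθ'
  have hcos : |Real.cos θ - Real.cos θ'| ≤ L := by
    refine le_trans ?_ hp
    simpa [-Complex.ofReal_cos, Complex.norm_exp_I_mul_ofReal, abs_of_nonneg hc,
      abs_of_nonneg hc'] using
      abs_norm_sub_norm_le (Real.cos θ * Complex.exp (Complex.I * φ) : ℂ)
        (Real.cos θ' * Complex.exp (Complex.I * φ'))
  have hang : |θ - θ'| ≤ Real.pi * L := by
    refine abs_sub_le_chord ?_ hcos (by rwa [abs_sub_comm])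
    rw [abs_le]
    constructor <;> linarith [hθ.1, hθ.2, hθ'.1, hθ'.2]
  have hπL : Real.pi * L ≤ 4 * L := mul_le_mul_of_nonneg_right Real.pi_le_four hL
  rw [PhiD]
  split_ifs with hpole hτ
  · linarith
  all_goals
    obtain ⟨hn, hn'⟩ := not_or.1 hpole
    have hm := mul_norm_sub_le hc hc' (Complex.norm_exp_I_mul_ofReal φ)
      (Complex.norm_exp_I_mul_ofReal φ')
    have hfin := angular_le (cos_pos_of_mem_Icc hθ hn) (cos_pos_of_mem_Icc hθ' hn')
      (torusDist_nonneg φ φ') (torusDist_le_pi φ φ') hL (by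
        calc _ ≤ max (Real.cos θ) (Real.cos θ') * (Real.pi / 2 *
              ‖Complex.exp (Complex.I * φ) - Complex.exp (Complex.I * φ')‖) :=
              mul_le_mul_of_nonneg_left (torusDist_le_chord φ φ') (hc.trans (le_max_left _ _))
          _ ≤ Real.pi * ((|Real.sin θ| + L) * L) := by
              nlinarith [Real.pi_pos]
          _ ≤ _ := by
              have := Real.pi_pos
              gcongr
              exact le_max_left _ _)
  · rw [if_pos hτ] at hfin
    linarith
  · rw [if_neg hτ] at hfin
    linarith

theorem ofReal_PhiD_le_ccDist {θ θ' : ℝ} (hθ : θ ∈ Icc (-(Real.pi / 2)) (Real.pi / 2))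
    (hθ' : θ' ∈ Icc (-(Real.pi / 2)) (Real.pi / 2)) (φ φ' : ℝ) :
    ENNReal.ofReal (1 / 11 * PhiD θ φ θ' φ') ≤ ccDist (spt θ φ) (spt θ' φ') := by
  refine le_iInf fun γ => le_iInf fun a => le_iInf fun b => le_iInf fun h => le_iInf fun h0 =>
    le_iInf fun h1 => ?_
  rw [lintegral_horizSpeed h.2.1 h.2.2.1]
  apply ENNReal.ofReal_le_ofReal
  linarith [PhiD_le_of_isHoriz h hθ hθ' h0 h1]

/-- `z` and `z'` are joined by a horizontal curve of length `l`. -/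
def HorizJoin (z z' : E3) (l : ℝ) : Prop :=
  ∃ γ a b, IsHoriz γ a b ∧ γ 0 = z ∧ γ 1 = z' ∧ ∫ s in (0:ℝ)..1, horizSpeed a b s = l

/-- The concatenation of two real controls, run at double speed. -/
def concatControl (a a' : ℝ → ℝ) (t : ℝ) : ℝ :=
  if t ≤ 1 / 2 then 2 * a (2 * t) else 2 * a' (2 * t - 1)

section Concat

variable {F : Type*} [NormedAddCommGroup F] [NormedSpace ℝ F] {f g h : ℝ → F}

theorem intervalIntegrable_concat_left (hf : IntervalIntegrable f volume 0 1)
    (h₁ : ∀ t, t ≤ 1 / 2 → h t = (2:ℝ) • f (2 * t)) : IntervalIntegrable h volume 0 (1 / 2) := by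
  have := (hf.comp_mul_left (c := 2)).smul (2:ℝ)
  rw [zero_div] at this
  refine this.congr fun t ht => ?_
  rw [uIoc_of_le (by norm_num)] at ht
  exact (h₁ t ht.2).symm

theorem intervalIntegrable_concat_right (hg : IntervalIntegrable g volume 0 1)
    (h₂ : ∀ t, 1 / 2 < t → h t = (2:ℝ) • g (2 * t - 1)) :
    IntervalIntegrable h volume (1 / 2) 1 := by
  have := ((hg.comp_sub_right 1).comp_mul_left (c := 2)).smul (2:ℝ)
  norm_num at this
  refine this.congr fun t ht => ?_
  rw [uIoc_of_le (by norm_num)] at ht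
  exact (h₂ t ht.1).symm

theorem integral_concat_left (h₁ : ∀ t, t ≤ 1 / 2 → h t = (2:ℝ) • f (2 * t)) {t : ℝ} (ht0 : 0 ≤ t)
    (ht : t ≤ 1 / 2) : ∫ s in (0:ℝ)..t, h s = ∫ s in (0:ℝ)..(2 * t), f s := by
  rw [← mul_zero (2:ℝ), ← intervalIntegral.smul_integral_comp_mul_left,
    ← intervalIntegral.integral_smul, mul_zero]
  refine intervalIntegral.integral_congr fun s hs => ?_
  rw [uIcc_of_le ht0] at hs
  exact h₁ s (hs.2.trans ht)

theorem integral_concat_right (h₂ : ∀ t, 1 / 2 < t → h t = (2:ℝ) • g (2 * t - 1)) {t : ℝ}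
    (ht : 1 / 2 ≤ t) : ∫ s in (1 / 2 : ℝ)..t, h s = ∫ s in (0:ℝ)..(2 * t - 1), g s := by
  have e : (0:ℝ) = 2 * (1 / 2) - 1 := by norm_num
  rw [e, ← intervalIntegral.smul_integral_comp_mul_sub, ← intervalIntegral.integral_smul]
  refine intervalIntegral.integral_congr_ae (Filter.Eventually.of_forall fun s hs => ?_)
  rw [uIoc_of_le ht] at hs
  exact h₂ s hs.1

theorem integral_concat (hf : IntervalIntegrable f volume 0 1)
    (hg : IntervalIntegrable g volume 0 1)
    (h₁ : ∀ t, t ≤ 1 / 2 → h t = (2:ℝ) • f (2 * t))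
    (h₂ : ∀ t, 1 / 2 < t → h t = (2:ℝ) • g (2 * t - 1)) {t : ℝ} (ht : t ∈ Icc (0:ℝ) 1) :
    ∫ s in (0:ℝ)..t, h s =
      (∫ s in (0:ℝ)..(min (2 * t) 1), f s) + ∫ s in (0:ℝ)..(max (2 * t - 1) 0), g s := by
  rcases le_total t (1 / 2) with h' | h'
  · rw [min_eq_left (by linarith), max_eq_right (by linarith), intervalIntegral.integral_same,
      add_zero, integral_concat_left h₁ ht.1 h']
  · have hi := intervalIntegrable_concat_left hf h₁
    have hi' := (intervalIntegrable_concat_right hg h₂).mono_set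
      (c := 1 / 2) (d := t) (by
        rw [uIcc_of_le h', uIcc_of_le (by norm_num)]
        exact Icc_subset_Icc_right ht.2)
    rw [min_eq_right (by linarith), max_eq_left (by linarith),
      ← intervalIntegral.integral_add_adjacent_intervals hi hi',
      integral_concat_left h₁ (by norm_num) le_rfl, integral_concat_right h₂ h']
    norm_num

end Concat

theorem integrableOn_Icc_iff_intervalIntegrable {F : Type*} [NormedAddCommGroup F] {f : ℝ → F} :
    IntegrableOn f (Icc 0 1) ↔ IntervalIntegrable f volume 0 1 :=
  (intervalIntegrable_iff_integrableOn_Icc_of_le zero_le_one).symm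

theorem concatControl_of_le {a a' : ℝ → ℝ} {t : ℝ} (h : t ≤ 1 / 2) :
    concatControl a a' t = 2 * a (2 * t) := if_pos h

theorem concatControl_of_lt {a a' : ℝ → ℝ} {t : ℝ} (h : 1 / 2 < t) :
    concatControl a a' t = 2 * a' (2 * t - 1) := if_neg h.not_ge

theorem integrableOn_concatControl {a a' : ℝ → ℝ} (ha : IntegrableOn a (Icc 0 1))
    (ha' : IntegrableOn a' (Icc 0 1)) : IntegrableOn (concatControl a a') (Icc 0 1) := by
  rw [integrableOn_Icc_iff_intervalIntegrable] at *
  exact (intervalIntegrable_concat_left ha fun t ht => concatControl_of_le ht).trans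
    (intervalIntegrable_concat_right ha' fun t ht => concatControl_of_lt ht)

theorem IsHoriz.eq_add_integral {γ : ℝ → E3} {a b : ℝ → ℝ} (h : IsHoriz γ a b) {t : ℝ}
    (ht : t ∈ Icc (0:ℝ) 1) : γ t = γ 0 + ∫ s in (0:ℝ)..t, horizVel γ a b s := by
  rw [intervalIntegral.integral_of_le ht.1]
  exact h.2.2.2.2 t ht

theorem HorizJoin.trans {x y z : E3} {l l' : ℝ} (h : HorizJoin x y l) (h' : HorizJoin y z l') :
    HorizJoin x z (l + l') := by
  obtain ⟨γ, a, b, hγ, h0, h1, hl⟩ := h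
  obtain ⟨γ', a', b', hγ', h0', h1', hl'⟩ := h'
  have m1 : ∀ t ∈ Icc (0:ℝ) 1, min (2 * t) 1 ∈ Icc (0:ℝ) 1 := fun t ht =>
    ⟨le_min (by linarith [ht.1]) zero_le_one, min_le_right _ _⟩
  have m2 : ∀ t ∈ Icc (0:ℝ) 1, max (2 * t - 1) 0 ∈ Icc (0:ℝ) 1 := fun t ht =>
    ⟨le_max_right _ _, max_le (by linarith [ht.2]) zero_le_one⟩
  set Γ : ℝ → E3 := fun t => γ (min (2 * t) 1) + γ' (max (2 * t - 1) 0) - y with hΓ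
  have Γ1 : ∀ t, t ≤ 1 / 2 → Γ t = γ (2 * t) := fun t ht => by
    simp only [hΓ]
    rw [min_eq_left (by linarith), max_eq_right (by linarith), h0', add_sub_cancel_right]
  have Γ2 : ∀ t, 1 / 2 ≤ t → Γ t = γ' (2 * t - 1) := fun t ht => by
    simp only [hΓ]
    rw [min_eq_right (by linarith), max_eq_left (by linarith), h1, add_sub_cancel_left]
  have v1 : ∀ t, t ≤ 1 / 2 → horizVel Γ (concatControl a a') (concatControl b b') t
      = (2:ℝ) • horizVel γ a b (2 * t) := fun t ht => by
    rw [horizVel, horizVel, Γ1 t ht, concatControl_of_le ht, concatControl_of_le ht, mul_smul,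
      mul_smul, smul_add]
  have v2 : ∀ t, 1 / 2 < t → horizVel Γ (concatControl a a') (concatControl b b') t
      = (2:ℝ) • horizVel γ' a' b' (2 * t - 1) := fun t ht => by
    rw [horizVel, horizVel, Γ2 t ht.le, concatControl_of_lt ht, concatControl_of_lt ht, mul_smul,
      mul_smul, smul_add]
  have sp : ∀ u v : ℝ, √((2 * u) ^ 2 + (2 * v) ^ 2) = 2 * √(u ^ 2 + v ^ 2) := fun u v => by
    rw [show (2 * u) ^ 2 + (2 * v) ^ 2 = 2 ^ 2 * (u ^ 2 + v ^ 2) by ring,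
      Real.sqrt_mul (by positivity), Real.sqrt_sq (by norm_num)]
  have s1 : ∀ t, t ≤ 1 / 2 → horizSpeed (concatControl a a') (concatControl b b') t
      = (2:ℝ) • horizSpeed a b (2 * t) := fun t ht => by
    rw [horizSpeed, concatControl_of_le ht, concatControl_of_le ht, sp]
    rfl
  have s2 : ∀ t, 1 / 2 < t → horizSpeed (concatControl a a') (concatControl b b') t
      = (2:ℝ) • horizSpeed a' b' (2 * t - 1) := fun t ht => by
    rw [horizSpeed, concatControl_of_lt ht, concatControl_of_lt ht, sp]
    rfl
  have hvel := integrableOn_Icc_iff_intervalIntegrable.1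
    (integrableOn_horizVel hγ.1 hγ.2.1 hγ.2.2.1)
  have hvel' := integrableOn_Icc_iff_intervalIntegrable.1
    (integrableOn_horizVel hγ'.1 hγ'.2.1 hγ'.2.2.1)
  have hspd := integrableOn_Icc_iff_intervalIntegrable.1
    (integrableOn_horizSpeed hγ.2.1 hγ.2.2.1)
  have hspd' := integrableOn_Icc_iff_intervalIntegrable.1
    (integrableOn_horizSpeed hγ'.2.1 hγ'.2.2.1)
  have Γ0 : Γ 0 = x := by rw [Γ1 0 (by norm_num), mul_zero, h0]
  refine ⟨Γ, concatControl a a', concatControl b b', ⟨?_, ?_, ?_, ?_, ?_⟩, Γ0, ?_, ?_⟩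
  · refine ((hγ.1.comp (by fun_prop) m1).add (hγ'.1.comp (by fun_prop) m2)).sub
      continuousOn_const
  · exact integrableOn_concatControl hγ.2.1 hγ'.2.1
  · exact integrableOn_concatControl hγ.2.2.1 hγ'.2.2.1
  · intro t ht
    rcases le_total t (1 / 2) with h | h
    · rw [Γ1 t h]
      exact hγ.2.2.2.1 _ ⟨by linarith [ht.1], by linarith⟩
    · rw [Γ2 t h]
      exact hγ'.2.2.2.1 _ ⟨by linarith, by linarith [ht.2]⟩
  · intro t ht
    have e := integral_concat hvel hvel' v1 v2 ht
    rw [intervalIntegral.integral_of_le ht.1] at e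
    refine Eq.trans ?_ (congrArg (Γ 0 + ·) e.symm)
    simp only [hΓ]
    rw [hγ.eq_add_integral (m1 t ht), hγ'.eq_add_integral (m2 t ht)]
    have := Γ0
    simp only [hΓ] at this
    rw [this, h0, h0']
    abel
  · rw [Γ2 1 (by norm_num)]
    norm_num [h1']
  · rw [integral_concat hspd hspd' s1 s2 (right_mem_Icc.2 zero_le_one), ← hl, ← hl']
    norm_num

theorem HorizJoin.ccDist_le {z z' : E3} {l : ℝ} (h : HorizJoin z z' l) :
    ccDist z z' ≤ ENNReal.ofReal l := by
  obtain ⟨γ, a, b, hγ, h0, h1, hl⟩ := h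
  rw [← hl, ← lintegral_horizSpeed hγ.2.1 hγ.2.2.1]
  exact iInf_le_of_le γ <| iInf_le_of_le a <| iInf_le_of_le b <| iInf_le_of_le hγ <|
    iInf_le_of_le h0 <| iInf_le_of_le h1 le_rfl

theorem hasDerivAt_E3 {γ : ℝ → E3} {v : E3} {t : ℝ}
    (h : ∀ i, HasDerivAt (fun s => γ s i) (v i) t) : HasDerivAt γ v t :=
  (PiLp.continuousLinearEquiv 2 ℝ (fun _ : Fin 3 => ℝ)).symm.hasFDerivAt.comp_hasDerivAt t
    (hasDerivAt_pi.2 h)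

theorem isHoriz_of_hasDerivAt {γ : ℝ → E3} {a b : ℝ → ℝ} (ha : Continuous a) (hb : Continuous b)
    (hγ : ∀ t, γ t ∈ Metric.sphere (0 : E3) 1)
    (h : ∀ t, HasDerivAt γ (horizVel γ a b t) t) : IsHoriz γ a b := by
  have hc : Continuous γ := continuous_iff_continuousAt.2 fun t => (h t).continuousAt
  refine ⟨hc.continuousOn, ha.continuousOn.integrableOn_Icc, hb.continuousOn.integrableOn_Icc,
    fun t _ => hγ t, fun t ht => ?_⟩
  have hv : Continuous (horizVel γ a b) :=
    (ha.smul (continuous_Z1.comp hc)).add (hb.smul (continuous_Z2.comp hc))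
  have := intervalIntegral.integral_eq_sub_of_hasDerivAt (fun s _ => h s)
    (hv.intervalIntegrable 0 t)
  rw [intervalIntegral.integral_of_le ht.1] at this
  exact (add_eq_of_eq_sub' this).symm

theorem horizJoin_meridian (θ θ' φ : ℝ) : HorizJoin (spt θ φ) (spt θ' φ) |θ' - θ| := by
  set u := θ' - θ with hu
  refine ⟨fun t => spt (θ + t * u) φ, fun _ => -(u * Real.sin φ), fun _ => u * Real.cos φ,
    isHoriz_of_hasDerivAt continuous_const continuous_const (fun t => spt_mem_sphere _ _)
      fun t => hasDerivAt_E3 fun i => ?_, ?_, ?_, ?_⟩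
  · have hl : HasDerivAt (fun s : ℝ => θ + s * u) u t := by
      simpa using ((hasDerivAt_id t).mul_const u).const_add θ
    fin_cases i
    · convert! hl.cos.mul_const (Real.cos φ) using 1
      simp [horizVel]; ring
    · convert! hl.cos.mul_const (Real.sin φ) using 1
      simp [horizVel]; ring
    · convert! hl.sin using 1
      simp [horizVel]
      linear_combination Real.cos (θ + t * u) * u * Real.sin_sq_add_cos_sq φ
  · simp
  · simp [hu]
  · have e : (u * Real.sin φ) ^ 2 + (u * Real.cos φ) ^ 2 = u ^ 2 := by
      linear_combination u ^ 2 * Real.sin_sq_add_cos_sq φ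
    simp [horizSpeed, e, Real.sqrt_sq_eq_abs]

theorem horizJoin_parallel (θ φ : ℝ) {w v : ℝ} (h : w * Real.cos θ = v * Real.sin θ) :
    HorizJoin (spt θ φ) (spt θ (φ + w)) |v| := by
  refine ⟨fun t => spt θ (φ + t * w), fun t => v * Real.cos (φ + t * w),
    fun t => v * Real.sin (φ + t * w),
    isHoriz_of_hasDerivAt (by fun_prop) (by fun_prop) (fun t => spt_mem_sphere _ _)
      fun t => hasDerivAt_E3 fun i => ?_, ?_, ?_, ?_⟩
  · have hl : HasDerivAt (fun s : ℝ => φ + s * w) w t := by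
      simpa using ((hasDerivAt_id t).mul_const w).const_add φ
    fin_cases i
    · convert! hl.cos.const_mul (Real.cos θ) using 1
      simp [horizVel]
      linear_combination -Real.sin (φ + t * w) * h
    · convert! hl.sin.const_mul (Real.cos θ) using 1
      simp [horizVel]
      linear_combination -Real.cos (φ + t * w) * h
    · convert! hasDerivAt_const t (Real.sin θ) using 1
      simp [horizVel]; ring
  · simp
  · simp
  · have e : ∀ s, (v * Real.cos (φ + s * w)) ^ 2 + (v * Real.sin (φ + s * w)) ^ 2 = v ^ 2 := by
      intro s
      linear_combination v ^ 2 * Real.sin_sq_add_cos_sq (φ + s * w)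
    simp [horizSpeed, e, Real.sqrt_sq_eq_abs]

theorem horizJoin_parallel_torusDist {θ φ φ' : ℝ} (h : Real.tan θ ≠ 0 ∨ torusDist φ φ' = 0) :
    HorizJoin (spt θ φ) (spt θ φ') (torusDist φ φ' / |Real.tan θ|) := by
  obtain ⟨k, hk, -⟩ := exists_torusDist_eq φ φ'
  set w := -(φ - φ' + 2 * Real.pi * k) with hw
  have hd : torusDist φ φ' = |w| := by rw [hk, hw, abs_neg]
  have e : spt θ (φ + w) = spt θ φ' := by
    have : φ + w = φ' - k * (2 * Real.pi) := by rw [hw]; ring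
    rw [spt, this, Real.cos_sub_int_mul_two_pi, Real.sin_sub_int_mul_two_pi, spt]
  rw [← e, hd, ← abs_div]
  refine horizJoin_parallel θ φ ?_
  rcases h with h | h
  · have h1 := h
    rw [Real.tan_eq_sin_div_cos, div_ne_zero_iff] at h1
    rw [Real.tan_eq_sin_div_cos]
    field_simp [h1.1, h1.2]
  · rw [hd, abs_eq_zero] at h
    simp [h]

theorem horizJoin_three {θ θ' φ φ' : ℝ} (θ₁ : ℝ) (h : Real.tan θ₁ ≠ 0 ∨ torusDist φ φ' = 0) :
    HorizJoin (spt θ φ) (spt θ' φ')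
      (|θ₁ - θ| + torusDist φ φ' / |Real.tan θ₁| + |θ' - θ₁|) :=
  ((horizJoin_meridian θ θ₁ φ).trans (horizJoin_parallel_torusDist h)).trans
    (horizJoin_meridian θ₁ θ' φ')

theorem spt_eq_of_abs_eq {θ : ℝ} (h : |θ| = Real.pi / 2) (φ φ' : ℝ) : spt θ φ = spt θ φ' := by
  have : Real.cos θ = 0 := by rw [← Real.cos_abs, h, Real.cos_pi_div_two]
  simp [spt, this]

theorem abs_le_abs_tan {x : ℝ} (h : |x| < Real.pi / 2) : |x| ≤ |Real.tan x| := by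
  rcases le_total 0 x with h0 | h0
  · rw [abs_of_nonneg h0] at h ⊢
    exact (Real.le_tan h0 h).trans (le_abs_self _)
  · rw [abs_of_nonpos h0] at h ⊢
    have := Real.le_tan (neg_nonneg.2 h0) h
    rw [Real.tan_neg] at this
    exact this.trans (neg_le_abs _)

theorem exists_horizJoin {θ θ' : ℝ} (hθ : θ ∈ Icc (-(Real.pi / 2)) (Real.pi / 2))
    (hθ' : θ' ∈ Icc (-(Real.pi / 2)) (Real.pi / 2)) (φ φ' : ℝ) :
    ∃ l, HorizJoin (spt θ φ) (spt θ' φ') l ∧ l ≤ 5 * PhiD θ φ θ' φ' := by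
  have hab := abs_nonneg (θ - θ')
  by_cases hpole : |θ| = Real.pi / 2 ∨ |θ'| = Real.pi / 2
  · refine ⟨|θ' - θ|, ?_, ?_⟩
    · rcases hpole with h | h
      · rw [spt_eq_of_abs_eq h φ φ']
        exact horizJoin_meridian θ θ' φ'
      · rw [spt_eq_of_abs_eq h φ' φ]
        exact horizJoin_meridian θ θ' φ
    · rw [PhiD, if_pos hpole, abs_sub_comm]
      linarith
  have hlt : |θ| < Real.pi / 2 := (abs_le.2 hθ).lt_of_ne (not_or.1 hpole).1
  have hlt' : |θ'| < Real.pi / 2 := (abs_le.2 hθ').lt_of_ne (not_or.1 hpole).2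
  rw [PhiD, if_neg hpole]
  set d := torusDist φ φ' with hd
  have hd0 : 0 ≤ d := torusDist_nonneg φ φ'
  set τ := max |Real.tan θ| |Real.tan θ'| with hτ
  have hτ0 : 0 ≤ τ := (abs_nonneg _).trans (le_max_left _ _)
  have hsq := Real.sq_sqrt hd0
  have hs0 := Real.sqrt_nonneg d
  rcases le_or_gt (√d) τ with h | h
  · refine ⟨|θ - θ'| + d / τ, ?_, ?_⟩
    · have hor : τ ≠ 0 ∨ d = 0 := by
        rw [or_iff_not_imp_left, not_not]
        intro h0
        rw [h0] at h
        exact (Real.sqrt_eq_zero hd0).1 (le_antisymm h hs0)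
      rcases max_cases |Real.tan θ| |Real.tan θ'| with ⟨e, -⟩ | ⟨e, -⟩ <;>
        rw [← hτ] at e <;> rw [e] at hor ⊢ <;> rw [abs_ne_zero] at hor
      · have := horizJoin_three (θ := θ) (θ' := θ') θ hor
        rwa [sub_self, abs_zero, zero_add, add_comm, abs_sub_comm] at this
      · have := horizJoin_three (θ := θ) (θ' := θ') θ' hor
        rwa [sub_self, abs_zero, add_zero, abs_sub_comm] at this
    · split_ifs with h0
      · rw [h0, div_zero]
        linarith
      · have hτp : 0 < τ := hτ0.lt_of_ne' h0
        have h1 : d / τ ≤ √d := by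
          rw [div_le_iff₀ hτp]
          nlinarith
        rw [min_eq_right h1]
        linarith [div_nonneg hd0 hτ0]
  · have hsp : 0 < √d := hτ0.trans_lt h
    have htan : Real.tan (Real.arctan √d) = √d := Real.tan_arctan _
    have hj := horizJoin_three (θ := θ) (θ' := θ') (φ := φ) (φ' := φ') (Real.arctan √d)
      (Or.inl (by rw [htan]; exact hsp.ne'))
    refine ⟨_, hj, ?_⟩
    rw [htan, abs_of_pos hsp, ← hd, Real.div_sqrt]
    have h1 : |Real.arctan √d| ≤ √d := by
      have := abs_le_abs_tan (x := Real.arctan √d)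
        (abs_lt.2 ⟨Real.neg_pi_div_two_lt_arctan _, Real.arctan_lt_pi_div_two _⟩)
      rwa [htan, abs_of_pos hsp] at this
    have h2 : |θ| ≤ √d := (abs_le_abs_tan hlt).trans ((le_max_left _ _).trans h.le)
    have h3 : |θ'| ≤ √d := (abs_le_abs_tan hlt').trans ((le_max_right _ _).trans h.le)
    have h4 := abs_sub (Real.arctan √d) θ
    have h5 := abs_sub θ' (Real.arctan √d)
    have h6 : (if τ = 0 then √d else min √d (d / τ)) = √d := by
      split_ifs with h0
      · rfl
      · refine min_eq_left ?_
        rw [le_div_iff₀ (hτ0.lt_of_ne' h0)]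
        nlinarith
    rw [h6]
    linarith

theorem ccDist_le_ofReal_PhiD {θ θ' : ℝ} (hθ : θ ∈ Icc (-(Real.pi / 2)) (Real.pi / 2))
    (hθ' : θ' ∈ Icc (-(Real.pi / 2)) (Real.pi / 2)) (φ φ' : ℝ) :
    ccDist (spt θ φ) (spt θ' φ') ≤ ENNReal.ofReal (5 * PhiD θ φ θ' φ') := by
  obtain ⟨l, hj, hl⟩ := exists_horizJoin hθ hθ' φ φ'
  exact hj.ccDist_le.trans (ENNReal.ofReal_le_ofReal hl)

theorem PhiD_equator (φ φ' : ℝ) : PhiD 0 φ 0 φ' = √(torusDist φ φ') := by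
  have : ¬(0 = Real.pi / 2) := (div_pos Real.pi_pos two_pos).ne
  simp [PhiD, this]

/-- sharp two-sided estimate for the sub-Riemannian distance on the
Grushin sphere; in particular, on the equator `ϱ(⟨0,φ⟩,⟨0,φ'⟩) ≃ d_T(φ,φ')^{1/2}`. -/
theorem statement3 :
    ∃ c C : ℝ, 0 < c ∧ c ≤ C ∧
      (∀ θ θ' φ φ' : ℝ, θ ∈ Set.Icc (-(Real.pi/2)) (Real.pi/2) →
          θ' ∈ Set.Icc (-(Real.pi/2)) (Real.pi/2) →
          ENNReal.ofReal (c * PhiD θ φ θ' φ') ≤ ccDist (spt θ φ) (spt θ' φ') ∧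
          ccDist (spt θ φ) (spt θ' φ') ≤ ENNReal.ofReal (C * PhiD θ φ θ' φ')) ∧
      (∀ φ φ' : ℝ,
          ENNReal.ofReal (c * Real.sqrt (torusDist φ φ')) ≤ ccDist (spt 0 φ) (spt 0 φ') ∧
          ccDist (spt 0 φ) (spt 0 φ') ≤ ENNReal.ofReal (C * Real.sqrt (torusDist φ φ'))) := by
  have h0 : (0:ℝ) ∈ Icc (-(Real.pi / 2)) (Real.pi / 2) := by
    constructor <;> linarith [Real.pi_pos]
  refine ⟨1 / 11, 5, by norm_num, by norm_num, fun θ θ' φ φ' hθ hθ' =>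
    ⟨ofReal_PhiD_le_ccDist hθ hθ' φ φ', ccDist_le_ofReal_PhiD hθ hθ' φ φ'⟩, fun φ φ' => ?_⟩
  rw [← PhiD_equator]
  exact ⟨ofReal_PhiD_le_ccDist h0 h0 φ φ', ccDist_le_ofReal_PhiD h0 h0 φ φ'⟩
end
end

section
/- There exist constants 0 < c ≤ C such that for all θ ∈ [−π/2, π/2], φ ∈ ℝ and r > 0, c · min{1, r² max{r, |θ|}} ≤ σ({z ∈ S² : ϱ(z, ⟨θ,φ⟩) < r}) ≤ C · min{1, r² max{r, |θ|}}. -/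
open MeasureTheory Set
open scoped ENNReal NNReal

noncomputable section

/-- The surface measure `σ` on the unit sphere `S² ⊆ ℝ³` (total mass `4π`),
realised as the pushforward of `cosθ dθ dφ` under the spherical parametrization. -/
def sphereMeasure : Measure E3 :=
  Measure.map (fun p : ℝ × ℝ => spt p.1 p.2)
    (((volume : Measure (ℝ × ℝ)).restrict
        (Set.Ioc (-(Real.pi/2)) (Real.pi/2) ×ˢ Set.Ico (0:ℝ) (2*Real.pi))).withDensity
      (fun p => ENNReal.ofReal (Real.cos p.1)))

theorem continuous_spt : Continuous fun p : ℝ × ℝ => spt p.1 p.2 := by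
  refine (PiLp.continuous_toLp 2 _).comp (continuous_pi fun i => ?_)
  fin_cases i <;> simp <;> fun_prop

theorem integrableOn_velocity {γ : ℝ → E3} {a b : ℝ → ℝ}
    (hγ : ContinuousOn γ (Icc 0 1)) (ha : IntegrableOn a (Icc 0 1))
    (hb : IntegrableOn b (Icc 0 1)) :
    IntegrableOn (fun s => a s • Z1 (γ s) + b s • Z2 (γ s)) (Icc 0 1) :=
  (ha.smul_continuousOn (continuous_Z1.comp_continuousOn hγ) isCompact_Icc).add
    (hb.smul_continuousOn (continuous_Z2.comp_continuousOn hγ) isCompact_Icc)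

/-- A curve with bounded measurable controls which is differentiable off a countable set bounds the
Carnot–Carathéodory distance of its endpoints. -/
theorem ccDist_le_of_hasDerivAt {γ : ℝ → E3} {a b : ℝ → ℝ} {L : ℝ} {s : Set ℝ} (hs : s.Countable)
    (hγ : Continuous γ) (hsph : ∀ t, γ t ∈ Metric.sphere (0 : E3) 1)
    (ha : Measurable a) (hb : Measurable b) (hL : 0 ≤ L) (hab : ∀ t, a t ^ 2 + b t ^ 2 ≤ L ^ 2)
    (hd : ∀ t, t ∉ s → HasDerivAt γ (a t • Z1 (γ t) + b t • Z2 (γ t)) t) :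
    ccDist (γ 0) (γ 1) ≤ ENNReal.ofReal L := by
  have hint : ∀ f : ℝ → ℝ, Measurable f → (∀ t, f t ^ 2 ≤ L ^ 2) → IntegrableOn f (Icc 0 1) := by
    intro f hf hfL
    refine IntegrableOn.of_bound measure_Icc_lt_top hf.aestronglyMeasurable L
      (.of_forall fun t => ?_)
    exact abs_le_of_sq_le_sq (hfL t) hL
  have hia := hint a ha fun t => by nlinarith [hab t, sq_nonneg (b t)]
  have hib := hint b hb fun t => by nlinarith [hab t, sq_nonneg (a t)]
  have hor : IsHoriz γ a b := by
    refine ⟨hγ.continuousOn, hia, hib, fun t _ => hsph t, fun t ht => ?_⟩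
    rw [← intervalIntegral.integral_of_le ht.1, integral_eq_of_hasDerivAt_off_countable γ _ hs
      hγ.continuousOn (fun x hx => hd x hx.2), add_sub_cancel]
    rw [intervalIntegrable_iff_integrableOn_Ioc_of_le ht.1]
    exact (integrableOn_velocity hγ.continuousOn hia hib).mono_set
      (Ioc_subset_Icc_self.trans (Icc_subset_Icc_right ht.2))
  have hle : ccDist (γ 0) (γ 1) ≤
      ∫⁻ t in Icc (0 : ℝ) 1, ENNReal.ofReal (Real.sqrt (a t ^ 2 + b t ^ 2)) := by
    unfold ccDist
    exact iInf_le_of_le γ <| iInf_le_of_le a <| iInf_le_of_le b <| iInf_le_of_le hor <|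
      iInf_le_of_le rfl <| iInf_le_of_le rfl le_rfl
  refine hle.trans ?_
  calc ∫⁻ t in Icc (0 : ℝ) 1, ENNReal.ofReal (Real.sqrt (a t ^ 2 + b t ^ 2))
      ≤ ∫⁻ _ in Icc (0 : ℝ) 1, ENNReal.ofReal L := by
        refine lintegral_mono fun t => ENNReal.ofReal_le_ofReal ?_
        exact Real.sqrt_le_iff.2 ⟨hL, hab t⟩
    _ = ENNReal.ofReal L := by simp

/-- Length bound for a curve in latitude-longitude coordinates; `w` is the horizontal speed in the
longitude direction. -/
theorem ccDist_spt_le {Θ Φ u v w : ℝ → ℝ} {L : ℝ} {s : Set ℝ} (hs : s.Countable)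
    (hΘ : Continuous Θ) (hΦ : Continuous Φ) (hu : Measurable u) (hw : Measurable w)
    (hL : 0 ≤ L) (huw : ∀ t, u t ^ 2 + w t ^ 2 ≤ L ^ 2)
    (hdΘ : ∀ t, t ∉ s → HasDerivAt Θ (u t) t) (hdΦ : ∀ t, t ∉ s → HasDerivAt Φ (v t) t)
    (hvw : ∀ t, t ∉ s → v t * Real.cos (Θ t) = w t * Real.sin (Θ t)) :
    ccDist (spt (Θ 0) (Φ 0)) (spt (Θ 1) (Φ 1)) ≤ ENNReal.ofReal L := by
  have hγ : Continuous fun t => spt (Θ t) (Φ t) := 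
    continuous_spt.comp (f := fun t => (Θ t, Φ t)) (hΘ.prodMk hΦ)
  have hd : ∀ t, t ∉ s → HasDerivAt (fun t => spt (Θ t) (Φ t))
      ((-u t * Real.sin (Φ t) + w t * Real.cos (Φ t)) • Z1 (spt (Θ t) (Φ t)) +
        (u t * Real.cos (Φ t) + w t * Real.sin (Φ t)) • Z2 (spt (Θ t) (Φ t))) t := by
    intro t ht
    have h1 := hdΘ t ht
    have h2 := hdΦ t ht
    have h3 := hvw t ht
    refine hasDerivAt_E3 (Fin.forall_fin_succ.2 ⟨?_, Fin.forall_fin_two.2 ⟨?_, ?_⟩⟩)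
    · change HasDerivAt (fun t => Real.cos (Θ t) * Real.cos (Φ t)) _ t
      refine (h1.cos.mul h2.cos).congr_deriv ?_
      simp
      linear_combination -Real.sin (Φ t) * h3
    · change HasDerivAt (fun t => Real.cos (Θ t) * Real.sin (Φ t)) _ t
      refine (h1.cos.mul h2.sin).congr_deriv ?_
      simp
      linear_combination Real.cos (Φ t) * h3
    · change HasDerivAt (fun t => Real.sin (Θ t)) _ t
      refine h1.sin.congr_deriv ?_
      simp
      linear_combination (-Real.cos (Θ t) * u t) * Real.sin_sq_add_cos_sq (Φ t)
  have hsin := Real.measurable_sin.comp hΦ.measurable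
  have hcos := Real.measurable_cos.comp hΦ.measurable
  have hab : ∀ t, (-u t * Real.sin (Φ t) + w t * Real.cos (Φ t)) ^ 2 +
      (u t * Real.cos (Φ t) + w t * Real.sin (Φ t)) ^ 2 ≤ L ^ 2 := fun t => by
    refine le_of_eq_of_le ?_ (huw t)
    linear_combination (u t ^ 2 + w t ^ 2) * Real.sin_sq_add_cos_sq (Φ t)
  have ha : Measurable fun t => -u t * Real.sin (Φ t) + w t * Real.cos (Φ t) :=
    (hu.neg.mul hsin).add (hw.mul hcos)
  have hb : Measurable fun t => u t * Real.cos (Φ t) + w t * Real.sin (Φ t) :=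
    (hu.mul hcos).add (hw.mul hsin)
  have hle := ccDist_le_of_hasDerivAt hs hγ (fun t => spt_mem_sphere _ _) ha hb hL hab hd
  exact hle

theorem hasDerivAt_of_eqOn_affine {f : ℝ → ℝ} {c d t : ℝ} {U : Set ℝ} (hU : IsOpen U) (ht : t ∈ U)
    (h : ∀ x ∈ U, f x = c + d * x) : HasDerivAt f d t := by
  have := ((hasDerivAt_id t).const_mul d).const_add c
  rw [mul_one] at this
  exact this.congr_of_eventuallyEq (Filter.eventually_of_mem (hU.mem_nhds ht) h)

/-- The distance bound from the path along a meridian to latitude `m`, then along a parallel,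
then along a meridian. -/
theorem ccDist_spt_spt_le {θ θ' φ φ' m k r : ℝ} (h1 : |m - θ'| ≤ r) (h2 : |k| ≤ r)
    (h3 : |θ - m| ≤ r) (hk : (φ - φ') * Real.cos m = k * Real.sin m) :
    ccDist (spt θ' φ') (spt θ φ) ≤ ENNReal.ofReal (3 * r) := by
  have hr : 0 ≤ r := (abs_nonneg _).trans h1
  have hsq : ∀ x : ℝ, |x| ≤ r → (3 * x) ^ 2 ≤ (3 * r) ^ 2 := fun x hx => by
    have := sq_le_sq' (abs_le.1 hx).1 (abs_le.1 hx).2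
    nlinarith
  have key := ccDist_spt_le (s := {1 / 3, 2 / 3}) (L := 3 * r)
    (Θ := fun t => θ' + (m - θ') * min (3 * t) 1 + (θ - m) * max (3 * t - 2) 0)
    (Φ := fun t => φ' + (φ - φ') * max 0 (min (3 * t - 1) 1))
    (u := fun t => if t < 1 / 3 then 3 * (m - θ') else if t < 2 / 3 then 0 else 3 * (θ - m))
    (v := fun t => if t < 1 / 3 then 0 else if t < 2 / 3 then 3 * (φ - φ') else 0)
    (w := fun t => if t < 1 / 3 then 0 else if t < 2 / 3 then 3 * k else 0)
    (Set.toFinite _).countable (by fun_prop) (by fun_prop)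
    (Measurable.ite measurableSet_Iio measurable_const
      (Measurable.ite measurableSet_Iio measurable_const measurable_const))
    (Measurable.ite measurableSet_Iio measurable_const
      (Measurable.ite measurableSet_Iio measurable_const measurable_const))
    (by positivity) ?_ ?_ ?_ ?_
  · convert key using 2 <;> norm_num
  · intro t
    have := hsq _ h1
    have := hsq _ h2
    have := hsq _ h3
    split_ifs <;> nlinarith
  · intro t ht
    simp only [mem_insert_iff, mem_singleton_iff, not_or] at ht
    split_ifs with h h'
    · refine hasDerivAt_of_eqOn_affine (c := θ') isOpen_Iio h fun x (hx : x < 1 / 3) => ?_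
      rw [min_eq_left (by linarith), max_eq_right (by linarith)]
      ring
    · have h0 : t ∈ Ioo (1 / 3 : ℝ) (2 / 3) := ⟨lt_of_le_of_ne (not_lt.1 h) (Ne.symm ht.1), h'⟩
      refine hasDerivAt_of_eqOn_affine (c := m) isOpen_Ioo h0 fun x hx => ?_
      rw [min_eq_right (by linarith [hx.1]), max_eq_right (by linarith [hx.2])]
      ring
    · have h0 : t ∈ Ioi (2 / 3 : ℝ) := lt_of_le_of_ne (not_lt.1 h') (Ne.symm ht.2)
      refine hasDerivAt_of_eqOn_affine (c := m - 2 * (θ - m)) isOpen_Ioi h0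
        fun x (hx : 2 / 3 < x) => ?_
      rw [min_eq_right (by linarith), max_eq_left (by linarith)]
      ring
  · intro t ht
    simp only [mem_insert_iff, mem_singleton_iff, not_or] at ht
    split_ifs with h h'
    · refine hasDerivAt_of_eqOn_affine (c := φ') isOpen_Iio h fun x (hx : x < 1 / 3) => ?_
      rw [min_eq_left (by linarith), max_eq_left (by linarith)]
      ring
    · have h0 : t ∈ Ioo (1 / 3 : ℝ) (2 / 3) := ⟨lt_of_le_of_ne (not_lt.1 h) (Ne.symm ht.1), h'⟩
      refine hasDerivAt_of_eqOn_affine (c := φ' - (φ - φ')) isOpen_Ioo h0 fun x hx => ?_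
      rw [min_eq_left (by linarith [hx.2]), max_eq_right (by linarith [hx.1])]
      ring
    · have h0 : t ∈ Ioi (2 / 3 : ℝ) := lt_of_le_of_ne (not_lt.1 h') (Ne.symm ht.2)
      refine hasDerivAt_of_eqOn_affine (c := φ) isOpen_Ioi h0 fun x (hx : 2 / 3 < x) => ?_
      rw [min_eq_right (by linarith), max_eq_right (by linarith)]
      ring
  · intro t ht
    split_ifs with h h'
    · simp
    · rw [min_eq_right (by linarith), max_eq_right (by linarith)]
      simp only [mul_one, mul_zero, add_zero, add_sub_cancel]
      linear_combination 3 * hk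
    · simp

theorem abs_le_sqrt_sq_add_sq_left (x y : ℝ) : |x| ≤ Real.sqrt (x ^ 2 + y ^ 2) :=
  Real.abs_le_sqrt (by nlinarith [sq_nonneg y])

theorem abs_le_sqrt_sq_add_sq_right (x y : ℝ) : |y| ≤ Real.sqrt (x ^ 2 + y ^ 2) :=
  Real.abs_le_sqrt (by nlinarith [sq_nonneg x])

/-- A coordinate of a horizontal curve varies by at most the integral of its speed. -/
theorem IsHoriz.abs_sub_le {γ : ℝ → E3} {a b g : ℝ → ℝ} (h : IsHoriz γ a b) (i : Fin 3)
    (hg : IntegrableOn g (Icc 0 1))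
    (hbd : ∀ s ∈ Icc (0 : ℝ) 1, |(a s • Z1 (γ s) + b s • Z2 (γ s)) i| ≤ g s)
    {t : ℝ} (ht : t ∈ Icc (0 : ℝ) 1) :
    |γ t i - γ 1 i| ≤ ∫ s in Icc (0 : ℝ) 1, g s := by
  obtain ⟨hγ, ha, hb, -, heq⟩ := h
  have hv := integrableOn_velocity hγ ha hb
  set V := fun s => a s • Z1 (γ s) + b s • Z2 (γ s) with hV
  have hsplit : γ 1 - γ t = ∫ s in Ioc t 1, V s := by
    rw [heq t ht, heq 1 (by simp), ← Ioc_union_Ioc_eq_Ioc ht.1 ht.2,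
      setIntegral_union (Ioc_disjoint_Ioc_of_le le_rfl) measurableSet_Ioc
        (hv.mono_set (Ioc_subset_Icc_self.trans (Icc_subset_Icc_right ht.2)))
        (hv.mono_set (Ioc_subset_Icc_self.trans (Icc_subset_Icc_left ht.1)))]
    abel
  have hsub : Ioc t 1 ⊆ Icc (0 : ℝ) 1 := Ioc_subset_Icc_self.trans (Icc_subset_Icc_left ht.1)
  have hi : γ 1 i - γ t i = ∫ s in Ioc t 1, V s i := by
    have := (EuclideanSpace.proj (𝕜 := ℝ) i).integral_comp_comm (hv.mono_set hsub)
    rw [← hsplit] at this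
    exact this.symm
  rw [abs_sub_comm, hi]
  refine (norm_integral_le_of_norm_le (hg.mono_set hsub)
    ((ae_restrict_iff' measurableSet_Ioc).2
      (.of_forall fun s hs => (Real.norm_eq_abs _).trans_le (hbd s (hsub hs))))).trans ?_
  refine setIntegral_mono_set hg ?_ hsub.eventuallyLE
  exact (ae_restrict_iff' measurableSet_Icc).2
    (.of_forall fun s hs => (abs_nonneg _).trans (hbd s hs))

/-- The ball is contained in a Euclidean box adapted to the horizontal distribution. -/
theorem abs_sub_le_of_ccDist_lt {z p : E3} {r : ℝ} (h : ccDist z p < ENNReal.ofReal r) :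
    |z 2 - p 2| ≤ r ∧ |z 0 - p 0| ≤ r * (|p 2| + r) ∧ |z 1 - p 1| ≤ r * (|p 2| + r) := by
  simp only [ccDist, iInf_lt_iff] at h
  obtain ⟨γ, a, b, hor, rfl, rfl, hlt⟩ := h
  have ⟨hγ, ha, hb, hsph, heq⟩ := hor
  set l := fun t => Real.sqrt (a t ^ 2 + b t ^ 2) with hl
  have hlint : IntegrableOn l (Icc 0 1) := by
    refine (ha.norm.add hb.norm).mono' (Real.continuous_sqrt.comp_aestronglyMeasurable
      ((ha.aestronglyMeasurable.pow 2).add (hb.aestronglyMeasurable.pow 2)))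
      (.of_forall fun t => ?_)
    rw [Real.norm_of_nonneg (Real.sqrt_nonneg _)]
    refine Real.sqrt_le_iff.2 ⟨add_nonneg (norm_nonneg _) (norm_nonneg _), ?_⟩
    simp only [Pi.add_apply, Real.norm_eq_abs]
    nlinarith [sq_abs (a t), sq_abs (b t), abs_nonneg (a t), abs_nonneg (b t)]
  have hlr : ∫ t in Icc (0 : ℝ) 1, l t < r := by
    rw [← ofReal_integral_eq_lintegral_ofReal hlint (.of_forall fun t => Real.sqrt_nonneg _)] at hlt
    exact (ENNReal.ofReal_lt_ofReal_iff_of_nonneg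
      (integral_nonneg fun t => Real.sqrt_nonneg _)).1 hlt
  have hr : 0 ≤ r := (integral_nonneg fun t => Real.sqrt_nonneg _).trans hlr.le
  have h2 : ∀ t ∈ Icc (0 : ℝ) 1, |γ t 2 - γ 1 2| ≤ r := fun t ht => by
    refine (hor.abs_sub_le 2 hlint (fun s hs => ?_) ht).trans hlr.le
    have h1 := hsph s hs
    rw [mem_sphere_zero_iff_norm, ← sq_eq_sq₀ (norm_nonneg _) zero_le_one,
      EuclideanSpace.real_norm_sq_eq, Fin.sum_univ_three] at h1
    refine Real.abs_le_sqrt ?_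
    simp
    nlinarith [sq_nonneg (a s * γ s 0 + b s * γ s 1),
      mul_nonneg (add_nonneg (sq_nonneg (a s)) (sq_nonneg (b s))) (sq_nonneg (γ s 2))]
  have h2' : ∀ t ∈ Icc (0 : ℝ) 1, |γ t 2| ≤ |γ 1 2| + r := fun t ht => by
    linarith [h2 t ht, abs_sub_abs_le_abs_sub (γ t 2) (γ 1 2)]
  have hK : ∫ t in Icc (0 : ℝ) 1, l t * (|γ 1 2| + r) ≤ r * (|γ 1 2| + r) := by
    rw [integral_mul_const]
    gcongr
  refine ⟨h2 0 (by simp), (hor.abs_sub_le 0 (hlint.mul_const _) (fun s hs => ?_)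
    (by simp)).trans hK, (hor.abs_sub_le 1 (hlint.mul_const _) (fun s hs => ?_)
    (by simp)).trans hK⟩
  · simp [abs_mul]
    exact mul_le_mul (abs_le_sqrt_sq_add_sq_right _ _) (h2' s hs) (abs_nonneg _)
      (Real.sqrt_nonneg _)
  · simp [abs_mul]
    exact mul_le_mul (abs_le_sqrt_sq_add_sq_left _ _) (h2' s hs) (abs_nonneg _)
      (Real.sqrt_nonneg _)

theorem exists_abs_sub_int_mul_pi_le (y : ℝ) :
    ∃ k : ℤ, |y / Real.pi - k| ≤ 1 / 2 ∧ |y - k * Real.pi| ≤ Real.pi / 2 * |Real.sin y| := by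
  have hpi := Real.pi_pos
  refine ⟨round (y / Real.pi), abs_sub_round _, ?_⟩
  set k := round (y / Real.pi)
  have hk : |y / Real.pi - k| ≤ 1 / 2 := abs_sub_round _
  have hy : y - k * Real.pi = (y / Real.pi - k) * Real.pi := by field_simp
  have h1 : |y - k * Real.pi| ≤ Real.pi / 2 := by
    rw [hy, abs_mul, abs_of_pos hpi]
    nlinarith
  have h2 := Real.mul_abs_le_abs_sin h1
  rw [Real.sin_sub_int_mul_pi, abs_mul, abs_zpow, abs_neg, abs_one, one_zpow, one_mul,
    div_mul_eq_mul_div, div_le_iff₀ hpi] at h2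
  linarith

/-- On a bounded range, sublevel sets of `|sin (x - c)|` have linearly small measure. -/
theorem volume_abs_sin_sub_le {c η : ℝ} (hc : c ∈ Icc (-(Real.pi / 2)) (2 * Real.pi))
    (hη : 0 ≤ η) :
    volume {x : ℝ | x ∈ Icc (-(Real.pi / 2)) (2 * Real.pi) ∧ |Real.sin (x - c)| ≤ η} ≤
      ENNReal.ofReal (7 * Real.pi * η) := by
  have hpi := Real.pi_pos
  have hsub : {x : ℝ | x ∈ Icc (-(Real.pi / 2)) (2 * Real.pi) ∧ |Real.sin (x - c)| ≤ η} ⊆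
      ⋃ k ∈ Finset.Icc (-3 : ℤ) 3, Metric.closedBall (c + k * Real.pi) (Real.pi / 2 * η) := by
    rintro x ⟨hx, hs⟩
    obtain ⟨k, hk, hk'⟩ := exists_abs_sub_int_mul_pi_le (x - c)
    simp only [mem_iUnion, Finset.mem_Icc, Metric.mem_closedBall, Real.dist_eq, exists_prop]
    refine ⟨k, ?_, ?_⟩
    · have h1 : (x - c) / Real.pi ≤ 5 / 2 := by
        rw [div_le_iff₀ hpi]
        linarith [hx.2, hc.1]
      have h2 : -(5 / 2) ≤ (x - c) / Real.pi := by
        rw [le_div_iff₀ hpi]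
        linarith [hx.1, hc.2]
      have h3 := abs_le.1 hk
      constructor
      · have : ((-3 : ℤ) : ℝ) ≤ k := by push_cast; linarith
        exact_mod_cast this
      · have : (k : ℝ) ≤ (3 : ℤ) := by push_cast; linarith
        exact_mod_cast this
    · rw [← sub_sub]
      exact hk'.trans (by gcongr)
  refine (measure_mono hsub).trans ((measure_biUnion_finset_le _ _).trans ?_)
  simp only [Real.volume_closedBall]
  rw [← ENNReal.ofReal_sum_of_nonneg fun _ _ => by positivity, Finset.sum_const, Int.card_Icc]
  refine ENNReal.ofReal_le_ofReal (le_of_eq ?_)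
  simp
  ring

/-- The measure on the coordinate rectangle whose image is the surface measure. -/
def coordMeasure : Measure (ℝ × ℝ) :=
  ((volume : Measure (ℝ × ℝ)).restrict
    (Ioc (-(Real.pi / 2)) (Real.pi / 2) ×ˢ Ico (0 : ℝ) (2 * Real.pi))).withDensity
      (fun p => ENNReal.ofReal (Real.cos p.1))

theorem sphereMeasure_eq : sphereMeasure = coordMeasure.map fun p : ℝ × ℝ => spt p.1 p.2 := rfl

theorem coordMeasure_le {θ φ η₁ η₂ : ℝ} (hθ : θ ∈ Icc (-(Real.pi / 2)) (Real.pi / 2))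
    (hφ : φ ∈ Ico 0 (2 * Real.pi)) (h₁ : 0 ≤ η₁) (h₂ : 0 ≤ η₂) :
    coordMeasure {p | |Real.sin (p.1 - θ)| ≤ η₁ ∧ Real.cos p.1 * |Real.sin (p.2 - φ)| ≤ η₂} ≤
      ENNReal.ofReal (49 * Real.pi ^ 2 * (η₁ * η₂)) := by
  have hpi := Real.pi_pos
  set M : Set (ℝ × ℝ) :=
    {p | |Real.sin (p.1 - θ)| ≤ η₁ ∧ Real.cos p.1 * |Real.sin (p.2 - φ)| ≤ η₂} with hM
  have hMm : MeasurableSet M := by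
    refine ((isClosed_le (f := fun p : ℝ × ℝ => |Real.sin (p.1 - θ)|) ?_ ?_).inter
      (isClosed_le (f := fun p : ℝ × ℝ => Real.cos p.1 * |Real.sin (p.2 - φ)|)
        ?_ ?_)).measurableSet <;> fun_prop
  set I := Ioc (-(Real.pi / 2)) (Real.pi / 2)
  set J := Ico (0 : ℝ) (2 * Real.pi)
  set B : Set ℝ := {x | |Real.sin (x - θ)| ≤ η₁} with hB
  have hBm : MeasurableSet B := by
    refine IsClosed.measurableSet (isClosed_le ?_ ?_) <;> fun_prop
  have hIJ : (volume : Measure (ℝ × ℝ)).restrict (I ×ˢ J) =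
      (volume.restrict I).prod (volume.restrict J) := by
    rw [Measure.prod_restrict]; rfl
  have hcos : Measurable fun p : ℝ × ℝ => ENNReal.ofReal (Real.cos p.1) := by fun_prop
  have hinner : ∀ x ∈ I, ∫⁻ y in J, M.indicator (fun p => ENNReal.ofReal (Real.cos p.1)) (x, y) ≤
      B.indicator (fun _ => ENNReal.ofReal (7 * Real.pi * η₂)) x := by
    intro x hx
    have hc0 := Real.cos_nonneg_of_mem_Icc ⟨hx.1.le, hx.2⟩
    by_cases hxB : x ∈ B
    · rw [indicator_of_mem hxB]
      rcases hc0.eq_or_lt with h0 | h0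
      · refine le_of_eq_of_le (lintegral_eq_zero_of_ae_eq_zero (.of_forall fun y => ?_)) zero_le
        simp [indicator, ← h0]
      · set T : Set ℝ := {y | |Real.sin (y - φ)| ≤ η₂ / Real.cos x} with hT
        have hTm : MeasurableSet T := by
          refine IsClosed.measurableSet (isClosed_le ?_ ?_) <;> fun_prop
        calc ∫⁻ y in J, M.indicator (fun p => ENNReal.ofReal (Real.cos p.1)) (x, y)
            ≤ ∫⁻ y in J, T.indicator (fun _ => ENNReal.ofReal (Real.cos x)) y := by
              refine lintegral_mono fun y => ?_
              by_cases hy : (x, y) ∈ M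
              · have : y ∈ T := by
                  rw [hT, mem_ofPred_eq, le_div_iff₀ h0, mul_comm]
                  exact hy.2
                simp [hy, this]
              · simp [hy]
          _ = ENNReal.ofReal (Real.cos x) * volume (T ∩ J) := by
              rw [lintegral_indicator_const hTm, Measure.restrict_apply hTm]
          _ ≤ ENNReal.ofReal (Real.cos x) * ENNReal.ofReal (7 * Real.pi * (η₂ / Real.cos x)) := by
              gcongr
              refine (measure_mono fun y hy => ?_).trans (volume_abs_sin_sub_le (c := φ)
                ⟨by linarith [hφ.1], hφ.2.le⟩ (by positivity))
              exact ⟨⟨by linarith [hy.2.1], hy.2.2.le⟩, hy.1⟩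
          _ = ENNReal.ofReal (7 * Real.pi * η₂) := by
              rw [← ENNReal.ofReal_mul hc0]
              congr 1
              field_simp
    · refine le_of_eq_of_le (lintegral_eq_zero_of_ae_eq_zero (.of_forall fun y => ?_)) zero_le
      have : (x, y) ∉ M := fun h => hxB h.1
      simp [this]
  calc coordMeasure M
      = ∫⁻ x in I, ∫⁻ y in J, M.indicator (fun p => ENNReal.ofReal (Real.cos p.1)) (x, y) := by
        rw [coordMeasure, withDensity_apply _ hMm, hIJ, ← lintegral_indicator hMm,
          lintegral_prod _ (hcos.indicator hMm).aemeasurable]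
    _ ≤ ∫⁻ x in I, B.indicator (fun _ => ENNReal.ofReal (7 * Real.pi * η₂)) x :=
        setLIntegral_mono' measurableSet_Ioc hinner
    _ = ENNReal.ofReal (7 * Real.pi * η₂) * volume (B ∩ I) := by
        rw [lintegral_indicator_const hBm, Measure.restrict_apply hBm]
    _ ≤ ENNReal.ofReal (7 * Real.pi * η₂) * ENNReal.ofReal (7 * Real.pi * η₁) := by
        gcongr
        refine (measure_mono fun x hx => ?_).trans (volume_abs_sin_sub_le (c := θ)
          ⟨hθ.1, by linarith [hθ.2]⟩ h₁)
        exact ⟨⟨hx.2.1.le, by linarith [hx.2.2]⟩, hx.1⟩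
    _ = ENNReal.ofReal (49 * Real.pi ^ 2 * (η₁ * η₂)) := by
        rw [← ENNReal.ofReal_mul (by positivity)]
        congr 1
        ring

theorem le_coordMeasure {α β φ₁ φ₂ κ : ℝ} {S : Set (ℝ × ℝ)}
    (hα : -(Real.pi / 2) ≤ α) (hβ : β ≤ Real.pi / 2) (h₁ : 0 ≤ φ₁) (h₂ : φ₂ ≤ 2 * Real.pi)
    (hαβ : α ≤ β) (hφ : φ₁ ≤ φ₂)
    (hS : ∀ x ∈ Ioo α β, ∀ y ∈ Ioo φ₁ φ₂, (x, y) ∈ S ∧ κ ≤ Real.cos x) :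
    ENNReal.ofReal (κ * ((β - α) * (φ₂ - φ₁))) ≤ coordMeasure S := by
  rcases lt_or_ge κ 0 with hκ | hκ
  · rw [ENNReal.ofReal_of_nonpos]
    · exact zero_le
    · exact mul_nonpos_of_nonpos_of_nonneg hκ.le
        (mul_nonneg (sub_nonneg.2 hαβ) (sub_nonneg.2 hφ))
  have hR : MeasurableSet (Ioo α β ×ˢ Ioo φ₁ φ₂) := measurableSet_Ioo.prod measurableSet_Ioo
  have hsub : Ioo α β ×ˢ Ioo φ₁ φ₂ ⊆
      Ioc (-(Real.pi / 2)) (Real.pi / 2) ×ˢ Ico (0 : ℝ) (2 * Real.pi) := fun p hp =>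
    ⟨⟨hα.trans_lt hp.1.1, hp.1.2.le.trans hβ⟩, ⟨h₁.trans hp.2.1.le, hp.2.2.trans_le h₂⟩⟩
  calc ENNReal.ofReal (κ * ((β - α) * (φ₂ - φ₁)))
      = ∫⁻ _ in Ioo α β ×ˢ Ioo φ₁ φ₂, ENNReal.ofReal κ := by
        rw [setLIntegral_const, Measure.volume_eq_prod, Measure.prod_prod, Real.volume_Ioo,
          Real.volume_Ioo, ← ENNReal.ofReal_mul (sub_nonneg.2 hαβ), ← ENNReal.ofReal_mul hκ]
    _ ≤ ∫⁻ p in Ioo α β ×ˢ Ioo φ₁ φ₂, ENNReal.ofReal (Real.cos p.1) :=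
        setLIntegral_mono' hR fun p hp => ENNReal.ofReal_le_ofReal (hS _ hp.1 _ hp.2).2
    _ = coordMeasure (Ioo α β ×ˢ Ioo φ₁ φ₂) := by
        rw [coordMeasure, withDensity_apply _ hR, Measure.restrict_restrict hR,
          inter_eq_self_of_subset_left hsub]
    _ ≤ coordMeasure S := measure_mono fun p hp => (hS _ hp.1 _ hp.2).1

theorem exists_spt_eq (φ : ℝ) : ∃ ψ ∈ Ico 0 (2 * Real.pi), ∀ θ, spt θ φ = spt θ ψ := by
  refine ⟨toIcoMod Real.two_pi_pos 0 φ, by simpa using toIcoMod_mem_Ico Real.two_pi_pos 0 φ,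
    fun θ => ?_⟩
  rw [toIcoMod, spt, spt, zsmul_eq_mul, Real.cos_sub_int_mul_two_pi, Real.sin_sub_int_mul_two_pi]

theorem coordMeasure_mono {A B : Set (ℝ × ℝ)}
    (h : ∀ p ∈ A, p.1 ∈ Icc (-(Real.pi / 2)) (Real.pi / 2) → p ∈ B) :
    coordMeasure A ≤ coordMeasure B := by
  refine measure_mono_ae (withDensity_absolutelyContinuous _ _ ?_)
  filter_upwards [ae_restrict_mem (measurableSet_Ioc.prod measurableSet_Ico)] with p hp hA
  exact h p hA (Ioc_subset_Icc_self hp.1)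

theorem sphereMeasure_le_total (S : Set E3) :
    sphereMeasure S ≤ ENNReal.ofReal (49 * Real.pi ^ 2) := by
  have hpi := Real.pi_pos
  calc sphereMeasure S ≤ sphereMeasure univ := measure_mono (subset_univ _)
    _ = coordMeasure univ := by
        rw [sphereMeasure_eq, Measure.map_apply continuous_spt.measurable .univ, preimage_univ]
    _ ≤ coordMeasure {p | |Real.sin (p.1 - 0)| ≤ 1 ∧ Real.cos p.1 * |Real.sin (p.2 - 0)| ≤ 1} :=
        measure_mono fun p _ => ⟨Real.abs_sin_le_one _, by
          nlinarith [Real.cos_le_one p.1, Real.abs_sin_le_one (p.2 - 0),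
            abs_nonneg (Real.sin (p.2 - 0))]⟩
    _ ≤ _ := coordMeasure_le ⟨by linarith, by linarith⟩ ⟨le_rfl, by linarith⟩ zero_le_one
        zero_le_one
    _ = _ := by norm_num

theorem abs_mul_add_mul_le {c s x y δ : ℝ} (hc : |c| ≤ 1) (hs : |s| ≤ 1) (hx : |x| ≤ δ)
    (hy : |y| ≤ δ) : |c * x + s * y| ≤ 2 * δ := by
  have h1 : |c * x| ≤ δ := by
    rw [abs_mul]; nlinarith [abs_nonneg x]
  have h2 : |s * y| ≤ δ := by
    rw [abs_mul]; nlinarith [abs_nonneg y]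
  linarith [abs_add_le (c * x) (s * y)]

/-- Closeness in `ℝ³` implies closeness in latitude-longitude coordinates. -/
theorem abs_sin_coord_sub_le {θ φ θ' φ' r δ : ℝ} (hθ : 0 ≤ Real.cos θ) (hθ' : 0 ≤ Real.cos θ')
    (h0 : |Real.cos θ' * Real.cos φ' - Real.cos θ * Real.cos φ| ≤ δ)
    (h1 : |Real.cos θ' * Real.sin φ' - Real.cos θ * Real.sin φ| ≤ δ)
    (h2 : |Real.sin θ' - Real.sin θ| ≤ r) :
    |Real.sin (θ' - θ)| ≤ r + 2 * δ ∧ Real.cos θ' * |Real.sin (φ' - φ)| ≤ 2 * δ := by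
  constructor
  · have e1 := abs_mul_add_mul_le (Real.abs_cos_le_one φ) (Real.abs_sin_le_one φ) h0 h1
    have e2 := abs_mul_add_mul_le (Real.abs_cos_le_one φ') (Real.abs_sin_le_one φ') h0 h1
    have c1 := Real.cos_le_one (φ' - φ)
    rw [Real.cos_sub] at c1
    have h3 : |Real.cos θ' - Real.cos θ| ≤ 2 * δ := by
      rw [abs_le]
      constructor
      · nlinarith [(abs_le.1 e1).1, Real.sin_sq_add_cos_sq φ]
      · nlinarith [(abs_le.1 e2).2, Real.sin_sq_add_cos_sq φ']
    have e : Real.sin (θ' - θ) = Real.cos θ * (Real.sin θ' - Real.sin θ) +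
        -Real.sin θ * (Real.cos θ' - Real.cos θ) := by
      rw [Real.sin_sub]; ring
    have a1 : |Real.cos θ * (Real.sin θ' - Real.sin θ)| ≤ r := by
      rw [abs_mul]
      nlinarith [Real.abs_cos_le_one θ, abs_nonneg (Real.sin θ' - Real.sin θ)]
    have a2 : |-Real.sin θ * (Real.cos θ' - Real.cos θ)| ≤ 2 * δ := by
      rw [abs_mul, abs_neg]
      nlinarith [Real.abs_sin_le_one θ, abs_nonneg (Real.cos θ' - Real.cos θ)]
    rw [e]
    exact (abs_add_le _ _).trans (add_le_add a1 a2)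
  · rw [← abs_of_nonneg hθ', ← abs_mul]
    have := abs_mul_add_mul_le (c := -Real.sin φ) (by rw [abs_neg]; exact Real.abs_sin_le_one φ)
      (Real.abs_cos_le_one φ) h0 h1
    refine le_of_eq_of_le (congrArg _ ?_) this
    rw [Real.sin_sub]
    ring

theorem sphereMeasure_ball_le {θ φ r : ℝ} (hθ : θ ∈ Icc (-(Real.pi / 2)) (Real.pi / 2))
    (hφ : φ ∈ Ico 0 (2 * Real.pi)) (hr : 0 < r) (hr1 : r ≤ 1) :
    sphereMeasure {z : E3 | ccDist z (spt θ φ) < ENNReal.ofReal r} ≤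
      ENNReal.ofReal (980 * Real.pi ^ 2 * (r ^ 2 * max r |θ|)) := by
  set δ := r * (|Real.sin θ| + r) with hδ
  set m := max r |θ| with hm
  set N : Set E3 := {z | |z 2 - spt θ φ 2| ≤ r ∧ |z 0 - spt θ φ 0| ≤ δ ∧ |z 1 - spt θ φ 1| ≤ δ}
  have hN : MeasurableSet N := by
    refine ((isClosed_le (f := fun z : E3 => |z 2 - spt θ φ 2|) ?_ ?_).inter
      ((isClosed_le (f := fun z : E3 => |z 0 - spt θ φ 0|) ?_ ?_).inter
      (isClosed_le (f := fun z : E3 => |z 1 - spt θ φ 1|) ?_ ?_))).measurableSet <;> fun_prop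
  have hδ0 : 0 ≤ δ := by positivity
  have hδ1 : δ ≤ 2 * r := by
    rw [hδ]; nlinarith [Real.abs_sin_le_one θ]
  have hδ2 : δ ≤ 2 * (r * m) := by
    have h1 : |Real.sin θ| ≤ m := by
      have := Real.abs_sin_sub_sin_le θ 0
      rw [Real.sin_zero, sub_zero, sub_zero] at this
      exact this.trans (le_max_right _ _)
    have h2 : r ≤ m := le_max_left _ _
    rw [hδ]; nlinarith
  calc sphereMeasure {z : E3 | ccDist z (spt θ φ) < ENNReal.ofReal r}
      ≤ sphereMeasure N := measure_mono fun z hz => abs_sub_le_of_ccDist_lt hz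
    _ = coordMeasure ((fun p : ℝ × ℝ => spt p.1 p.2) ⁻¹' N) := by
        rw [sphereMeasure_eq, Measure.map_apply continuous_spt.measurable hN]
    _ ≤ coordMeasure {p | |Real.sin (p.1 - θ)| ≤ r + 2 * δ ∧
          Real.cos p.1 * |Real.sin (p.2 - φ)| ≤ 2 * δ} :=
        coordMeasure_mono fun p hp hp1 => abs_sin_coord_sub_le (Real.cos_nonneg_of_mem_Icc hθ)
          (Real.cos_nonneg_of_mem_Icc hp1) hp.2.1 hp.2.2 hp.1
    _ ≤ ENNReal.ofReal (49 * Real.pi ^ 2 * ((r + 2 * δ) * (2 * δ))) :=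
        coordMeasure_le hθ hφ (by positivity) (by positivity)
    _ ≤ _ := by
        refine ENNReal.ofReal_le_ofReal ?_
        have : (r + 2 * δ) * (2 * δ) ≤ (5 * r) * (4 * (r * m)) := by
          apply mul_le_mul <;> first | positivity | linarith
        nlinarith [sq_nonneg Real.pi]

theorem le_sphereMeasure_ball_of_rectangle {θ φ r m α l κ : ℝ} (hα : -(Real.pi / 2) ≤ α)
    (hα' : α + r / 2 ≤ Real.pi / 2) (hφ : φ ∈ Ico 0 (2 * Real.pi)) (hr : 0 < r)
    (hx : ∀ x ∈ Ioo α (α + r / 2), |m - x| ≤ r ∧ κ ≤ Real.cos x) (hθ : |θ - m| ≤ r)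
    (hm : Real.sin m ≠ 0) (hl0 : 0 ≤ l) (hl : l ≤ Real.pi)
    (hlm : |Real.cos m| * l ≤ r * |Real.sin m|) :
    ENNReal.ofReal (κ * (r / 2 * l)) ≤
      sphereMeasure {z : E3 | ccDist z (spt θ φ) < ENNReal.ofReal (4 * r)} := by
  have key : ∀ x ∈ Ioo α (α + r / 2), ∀ y, |φ - y| ≤ l →
      (x, y) ∈ (fun p : ℝ × ℝ => spt p.1 p.2) ⁻¹'
        {z : E3 | ccDist z (spt θ φ) < ENNReal.ofReal (4 * r)} ∧ κ ≤ Real.cos x := by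
    intro x hxm y hy
    refine ⟨?_, (hx x hxm).2⟩
    refine (ccDist_spt_spt_le (k := (φ - y) * Real.cos m / Real.sin m) (hx x hxm).1 ?_ hθ
      (by field_simp)).trans_lt ?_
    · rw [abs_div, div_le_iff₀ (abs_pos.2 hm), abs_mul]
      nlinarith [abs_nonneg (Real.cos m)]
    · exact (ENNReal.ofReal_lt_ofReal_iff (by linarith)).2 (by linarith)
  refine le_trans ?_ (Measure.le_map_apply continuous_spt.aemeasurable _)
  obtain ⟨φ₁, h0, h1, h2⟩ : ∃ φ₁, 0 ≤ φ₁ ∧ φ₁ + l ≤ 2 * Real.pi ∧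
      ∀ y ∈ Ioo φ₁ (φ₁ + l), |φ - y| ≤ l := by
    rcases le_total φ Real.pi with h | h
    · exact ⟨φ, hφ.1, by linarith, fun y hy => abs_le.2 ⟨by linarith [hy.2], by linarith [hy.1]⟩⟩
    · exact ⟨φ - l, by linarith, by linarith [hφ.2],
        fun y hy => abs_le.2 ⟨by linarith [hy.2], by linarith [hy.1]⟩⟩
  have := le_coordMeasure hα hα' h0 h1 (by linarith) (by linarith)
    fun x hx y hy => key x hx y (h2 y hy)
  rwa [add_sub_cancel_left, add_sub_cancel_left] at this

theorem le_sphereMeasure_ball {θ φ r : ℝ} (hθ : θ ∈ Icc (-(Real.pi / 2)) (Real.pi / 2))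
    (hφ : φ ∈ Ico 0 (2 * Real.pi)) (hr : 0 < r) (hr1 : r ≤ 1) :
    ENNReal.ofReal (r ^ 2 * max r |θ| / Real.pi) ≤
      sphereMeasure {z : E3 | ccDist z (spt θ φ) < ENNReal.ofReal (4 * r)} := by
  have hpi := Real.pi_pos
  have hpi3 := Real.pi_gt_three
  obtain ⟨m, hm⟩ : ∃ m, m = max r |θ| := ⟨_, rfl⟩
  have hmr : r ≤ m := hm ▸ le_max_left _ _
  have hmθ : |θ| ≤ m := hm ▸ le_max_right _ _
  have hmpi : m ≤ Real.pi / 2 := hm ▸ max_le (by linarith) (abs_le.2 hθ)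
  have hmθ' : m ≤ |θ| + r := hm ▸ max_le (by linarith [abs_nonneg θ]) (by linarith)
  have hsin : 2 / Real.pi * m ≤ Real.sin m := Real.mul_le_sin (by linarith) hmpi
  have hsin0 : 0 < Real.sin m := lt_of_lt_of_le (by have := hr.trans_le hmr; positivity) hsin
  have hcos0 : 0 ≤ Real.cos m := Real.cos_nonneg_of_mem_Icc ⟨by linarith, hmpi⟩
  obtain ⟨κ, hκ⟩ : ∃ κ, κ = max (Real.cos m) (r / Real.pi) := ⟨_, rfl⟩
  have hκcos : ∀ u, m - r ≤ u → u ≤ m - r / 2 → κ ≤ Real.cos u := by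
    intro u hu hu'
    refine hκ ▸ max_le (Real.cos_le_cos_of_nonneg_of_le_pi (by linarith) (by linarith)
      (by linarith)) ?_
    have := Real.mul_le_sin (x := Real.pi / 2 - u) (by linarith) (by linarith)
    rw [Real.sin_pi_div_two_sub] at this
    refine le_trans ?_ this
    rw [div_mul_eq_mul_div]
    gcongr
    linarith
  obtain ⟨l, hl0, hl, hlm, hκl⟩ : ∃ l, 0 ≤ l ∧ l ≤ Real.pi ∧
      Real.cos m * l ≤ r * Real.sin m ∧ 2 / Real.pi * (r * m) ≤ κ * l := by
    rcases le_or_gt (Real.cos m * Real.pi) (r * Real.sin m) with h | h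
    · refine ⟨Real.pi, hpi.le, le_rfl, h, ?_⟩
      calc 2 / Real.pi * (r * m) ≤ 2 / Real.pi * (r * (Real.pi / 2)) := by gcongr
        _ = r / Real.pi * Real.pi := by field_simp
        _ ≤ κ * Real.pi := by
          gcongr
          exact hκ ▸ le_max_right _ _
    · have hc : 0 < Real.cos m := by
        rcases hcos0.eq_or_lt with h0 | h0
        · rw [← h0, zero_mul] at h
          exact absurd h (not_lt.2 (by positivity))
        · exact h0
      have e : Real.cos m * (r * Real.sin m / Real.cos m) = r * Real.sin m := by field_simp
      refine ⟨r * Real.sin m / Real.cos m, by positivity, ?_, e.le, ?_⟩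
      · rw [div_le_iff₀ hc]
        linarith
      · calc 2 / Real.pi * (r * m) = r * (2 / Real.pi * m) := by ring
          _ ≤ r * Real.sin m := by gcongr
          _ = Real.cos m * (r * Real.sin m / Real.cos m) := e.symm
          _ ≤ κ * (r * Real.sin m / Real.cos m) := by
            gcongr
            exact hκ ▸ le_max_left _ _
  rw [← hm]
  have hfin : ENNReal.ofReal (r ^ 2 * m / Real.pi) ≤ ENNReal.ofReal (κ * (r / 2 * l)) := by
    refine ENNReal.ofReal_le_ofReal ?_
    calc r ^ 2 * m / Real.pi = r / 2 * (2 / Real.pi * (r * m)) := by ring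
      _ ≤ r / 2 * (κ * l) := by gcongr
      _ = κ * (r / 2 * l) := by ring
  refine hfin.trans ?_
  rcases le_total 0 θ with h | h
  · rw [abs_of_nonneg h] at hmθ hmθ'
    refine le_sphereMeasure_ball_of_rectangle (m := m) (α := m - r) (by linarith) (by linarith) hφ
      hr (fun x hx => ⟨abs_le.2 ⟨?_, ?_⟩, hκcos x hx.1.le (by linarith [hx.2])⟩)
      (abs_le.2 ⟨by linarith, by linarith⟩) hsin0.ne' hl0 hl ?_
    · linarith [hx.2]
    · linarith [hx.1]
    · rwa [abs_of_nonneg hcos0, abs_of_pos hsin0]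
  · rw [abs_of_nonpos h] at hmθ hmθ'
    refine le_sphereMeasure_ball_of_rectangle (m := -m) (α := -m + r / 2) (by linarith)
      (by linarith) hφ hr (fun x hx => ⟨abs_le.2 ⟨?_, ?_⟩, ?_⟩)
      (abs_le.2 ⟨by linarith, by linarith⟩) ?_ hl0 hl ?_
    · linarith [hx.2]
    · linarith [hx.1]
    · rw [← Real.cos_neg]
      exact hκcos (-x) (by linarith [hx.2]) (by linarith [hx.1])
    · rw [Real.sin_neg]
      exact neg_ne_zero.2 hsin0.ne'
    · rwa [Real.cos_neg, Real.sin_neg, abs_neg, abs_of_nonneg hcos0, abs_of_pos hsin0]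

/-- two-sided estimate for the volume of sub-Riemannian balls on the
Grushin sphere: `σ(B(⟨θ,φ⟩,r)) ≃ min{1, r² max{r, |θ|}}`.
(Points off the sphere are at infinite `ccDist` from everything, so the ball is
automatically a subset of `S²`.) -/
theorem statement4 :
    ∃ c C : ℝ, 0 < c ∧ c ≤ C ∧
      ∀ θ : ℝ, θ ∈ Set.Icc (-(Real.pi/2)) (Real.pi/2) → ∀ φ : ℝ, ∀ r : ℝ, 0 < r →
        ENNReal.ofReal (c * min 1 (r^2 * max r |θ|)) ≤
            sphereMeasure {z : E3 | ccDist z (spt θ φ) < ENNReal.ofReal r} ∧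
          sphereMeasure {z : E3 | ccDist z (spt θ φ) < ENNReal.ofReal r} ≤
            ENNReal.ofReal (C * min 1 (r^2 * max r |θ|)) := by
  have hpi := Real.pi_pos
  have hpi3 := Real.pi_gt_three
  refine ⟨1 / (64 * Real.pi), 980 * Real.pi ^ 2, by positivity, ?_, fun θ hθ φ r hr => ?_⟩
  · rw [div_le_iff₀ (by positivity)]
    nlinarith [pow_pos hpi 3]
  obtain ⟨ψ, hψ, hψe⟩ := exists_spt_eq φ
  rw [hψe θ]
  constructor
  · have hs0 : 0 < min r 1 := lt_min hr one_pos
    have hs1 : min r 1 ≤ 1 := min_le_right _ _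
    have hlow := le_sphereMeasure_ball hθ hψ (r := min r 1 / 4) (by positivity) (by linarith)
    refine le_trans (ENNReal.ofReal_le_ofReal ?_) (hlow.trans (measure_mono fun z hz => ?_))
    · have h1 : min 1 (r ^ 2 * max r |θ|) ≤ min r 1 ^ 2 * max (min r 1) |θ| := by
        rcases le_total r 1 with h | h
        · rw [min_eq_left h]
          exact min_le_right _ _
        · rw [min_eq_right h, one_pow, one_mul]
          exact (min_le_left _ _).trans (le_max_left _ _)
      have h2 : max (min r 1) |θ| / 4 ≤ max (min r 1 / 4) |θ| := by
        rw [← max_div_div_right (by norm_num : (0 : ℝ) ≤ 4)]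
        exact max_le_max le_rfl (by linarith [abs_nonneg θ])
      calc 1 / (64 * Real.pi) * min 1 (r ^ 2 * max r |θ|)
          ≤ 1 / (64 * Real.pi) * (min r 1 ^ 2 * max (min r 1) |θ|) := by gcongr
        _ = (min r 1 / 4) ^ 2 * (max (min r 1) |θ| / 4) / Real.pi := by field_simp; norm_num
        _ ≤ (min r 1 / 4) ^ 2 * max (min r 1 / 4) |θ| / Real.pi := by gcongr
    · refine lt_of_lt_of_le hz (ENNReal.ofReal_le_ofReal ?_)
      linarith [min_le_left r 1]
  · rcases le_total 1 (r ^ 2 * max r |θ|) with h | h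
    · rw [min_eq_left h, mul_one]
      refine (sphereMeasure_le_total _).trans (ENNReal.ofReal_le_ofReal ?_)
      nlinarith [sq_nonneg Real.pi]
    · rw [min_eq_right h]
      refine sphereMeasure_ball_le hθ hψ hr ?_
      by_contra! h1
      have h2 : 1 < max r |θ| := h1.trans_le (le_max_left _ _)
      nlinarith
end
end

section
/- There exists a constant C > 0 such that for all (ℓ,m) ∈ ℕ×ℤ with |m| ≤ ℓ and all x ∈ [−1,1], |Ỹ_{ℓ,m}(x)| (1−x²)^{1/4} ≤ C (1+ℓ)^{1/4}. -/
open MeasureTheory Set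
open scoped ENNReal NNReal

noncomputable section

/-- The Legendre polynomial `P_ℓ(x) = (2^ℓ ℓ!)⁻¹ (d/dx)^ℓ (x²−1)^ℓ`. -/
def legendreP (n : ℕ) (x : ℝ) : ℝ :=
  ((2:ℝ)^n * (Nat.factorial n : ℝ))⁻¹ * iteratedDeriv n (fun y => (y^2 - 1)^n) x

/-- The associated Legendre function `P_ℓ^m` for `0 ≤ m ≤ ℓ`
(on `[-1,1]`, where `√(1-x²)^m = (1-x²)^{m/2}`). -/
def assocP (n m : ℕ) (x : ℝ) : ℝ :=
  (-1:ℝ)^m * Real.sqrt (1 - x^2) ^ m * iteratedDeriv m (legendreP n) x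

/-- The associated Legendre function `P_ℓ^m` for integer `m` with `|m| ≤ ℓ`. -/
def assocPZ (n : ℕ) (m : ℤ) (x : ℝ) : ℝ :=
  if 0 ≤ m then assocP n m.toNat x
  else (-1:ℝ)^m.natAbs *
    ((Nat.factorial (n - m.natAbs) : ℝ) / (Nat.factorial (n + m.natAbs) : ℝ)) *
    assocP n m.natAbs x

/-- `Ỹ_{ℓ,m}(x) = ((2ℓ+1)/(4π) · (ℓ−m)!/(ℓ+m)!)^{1/2} P_ℓ^m(x)`. -/
def tY (n : ℕ) (m : ℤ) (x : ℝ) : ℝ :=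
  Real.sqrt (((2*(n:ℝ)+1) / (4*Real.pi)) *
    ((Nat.factorial ((n : ℤ) - m).toNat : ℝ) / (Nat.factorial ((n : ℤ) + m).toNat : ℝ))) *
  assocPZ n m x

/-- Iterated derivatives of polynomial functions are computed by formal derivatives. -/
lemma iteratedDeriv_polynomial_eval {𝕜 : Type*} [NontriviallyNormedField 𝕜]
    (p : Polynomial 𝕜) (k : ℕ) :
    iteratedDeriv k (fun y => p.eval y) = fun y => (Polynomial.derivative^[k] p).eval y := by
  induction k with
  | zero => simp
  | succ k ih =>
    rw [iteratedDeriv_succ, ih, Function.iterate_succ_apply']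
    ext y
    exact Polynomial.deriv _

lemma ofReal_iteratedDeriv_sq_sub_one_pow (n k : ℕ) (x : ℝ) :
    ((iteratedDeriv k (fun y : ℝ => (y ^ 2 - 1) ^ n) x : ℝ) : ℂ) =
      iteratedDeriv k (fun z : ℂ => (z ^ 2 - 1) ^ n) (x : ℂ) := by
  have h1 : (fun y : ℝ => (y ^ 2 - 1) ^ n) =
      fun y => ((Polynomial.X ^ 2 - 1 : Polynomial ℝ) ^ n).eval y := by
    ext y; simp
  have h2 : (fun z : ℂ => (z ^ 2 - 1) ^ n) =
      fun z => (((Polynomial.X ^ 2 - 1 : Polynomial ℝ) ^ n).map Complex.ofRealHom).eval z := by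
    ext y; simp
  rw [h1, h2, iteratedDeriv_polynomial_eval, iteratedDeriv_polynomial_eval,
    Polynomial.iterate_derivative_map]
  exact (Polynomial.eval_map_apply (f := Complex.ofRealHom) x).symm

/-- Cauchy's estimate for derivatives with the mean of `‖f‖` over the circle. -/
lemma norm_iteratedDeriv_le_integral_circle {f : ℂ → ℂ} (hf : Differentiable ℂ f) (c : ℂ)
    {R : ℝ} (hR : 0 < R) (n : ℕ) :
    ‖iteratedDeriv n f c‖ ≤
      (n.factorial : ℝ) / (2 * Real.pi * R ^ n) *
        ∫ t in (0 : ℝ)..2 * Real.pi, ‖f (circleMap c R t)‖ := by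
  have hc := DifferentiableOn.circleIntegral_one_div_sub_center_pow_smul (c := c) hR n
    hf.differentiableOn
  have hn : (0 : ℝ) < n.factorial := by positivity
  have h1 : ‖∮ z in C(c, R), (1 / (z - c) ^ (n + 1)) • f z‖ ≤
      (R ^ n)⁻¹ * ∫ t in (0 : ℝ)..2 * Real.pi, ‖f (circleMap c R t)‖ := by
    rw [← intervalIntegral.integral_const_mul]
    refine (intervalIntegral.norm_integral_le_integral_norm Real.two_pi_pos.le).trans (le_of_eq ?_)
    refine intervalIntegral.integral_congr fun t _ => ?_
    have hR' : |R| = R := abs_of_pos hR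
    simp only [deriv_circleMap, norm_smul, norm_mul, norm_div, norm_pow, Complex.norm_I,
      circleMap_sub_center, norm_circleMap_zero, hR', norm_one]
    field_simp
    ring
  rw [hc, norm_smul] at h1
  have h2 : ‖(2 * Real.pi * Complex.I / n.factorial : ℂ)‖ = 2 * Real.pi / n.factorial := by
    simp [abs_of_pos Real.pi_pos]
  rw [h2, ← le_div_iff₀' (by positivity)] at h1
  refine h1.trans (le_of_eq ?_)
  have := Real.pi_pos
  field_simp

lemma norm_sq_circleMap_sq_sub_one {x s : ℝ} (hs : s ^ 2 = 1 - x ^ 2) (r t : ℝ) :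
    ‖circleMap (x : ℂ) (s * r) t ^ 2 - 1‖ ^ 2 =
      s ^ 2 * ((1 + r ^ 2) ^ 2 - (2 * r * s * Real.cos t - x * (r ^ 2 - 1)) ^ 2) := by
  have h : circleMap (x : ℂ) (s * r) t =
      ((x + s * r * Real.cos t : ℝ) : ℂ) + ((s * r * Real.sin t : ℝ) : ℂ) * Complex.I := by
    rw [circleMap, Complex.exp_mul_I]
    push_cast
    ring
  have h3 : circleMap (x : ℂ) (s * r) t ^ 2 - 1 =
      (((x + s * r * Real.cos t) ^ 2 - (s * r * Real.sin t) ^ 2 - 1 : ℝ) : ℂ) +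
      ((2 * (x + s * r * Real.cos t) * (s * r * Real.sin t) : ℝ) : ℂ) * Complex.I := by
    rw [h]
    push_cast
    linear_combination (s * r * Complex.sin t) ^ 2 * Complex.I_sq
  rw [h3, Complex.sq_norm, Complex.normSq_add_mul_I]
  have hx : x ^ 2 = 1 - s ^ 2 := by linarith
  have hc : Real.sin t ^ 2 = 1 - Real.cos t ^ 2 := by linarith [Real.sin_sq_add_cos_sq t]
  grind

/-- On the circle of radius `s * r` about `x`, the modulus of `z ^ 2 - 1` has Gaussian decay
in `cos t` away from its maximum. -/
lemma norm_circleMap_sq_sub_one_pow_le {x s : ℝ} (hs0 : 0 < s) (hs : s ^ 2 = 1 - x ^ 2)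
    {r : ℝ} (hr : 0 < r) (n : ℕ) (t : ℝ) :
    ‖(circleMap (x : ℂ) (s * r) t ^ 2 - 1) ^ n‖ ≤
      (s * (1 + r ^ 2)) ^ n * (Real.exp 1 *
        Real.exp (-(r * s / (1 + r ^ 2) * √(n + 1) *
          (Real.cos t - x * (r ^ 2 - 1) / (2 * r * s))) ^ 2)) := by
  set τ : ℝ := (2 * r * s * Real.cos t - x * (r ^ 2 - 1)) / (1 + r ^ 2) with hτ
  have hr1 : 0 < 1 + r ^ 2 := by positivity
  have hsq := norm_sq_circleMap_sq_sub_one hs r t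
  have hfac : s ^ 2 * ((1 + r ^ 2) ^ 2 - (2 * r * s * Real.cos t - x * (r ^ 2 - 1)) ^ 2) =
      (s * (1 + r ^ 2)) ^ 2 * (1 - τ ^ 2) := by
    rw [hτ]; field_simp
  rw [hfac] at hsq
  have hτ1 : τ ^ 2 ≤ 1 := by
    by_contra! h
    have : (s * (1 + r ^ 2)) ^ 2 * (1 - τ ^ 2) < 0 :=
      mul_neg_of_pos_of_neg (by positivity) (by linarith)
    linarith [sq_nonneg ‖circleMap (x : ℂ) (s * r) t ^ 2 - 1‖]
  have hb : ‖circleMap (x : ℂ) (s * r) t ^ 2 - 1‖ ≤ s * (1 + r ^ 2) * Real.exp (-τ ^ 2 / 2) := by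
    refine (sq_le_sq₀ (norm_nonneg _) (by positivity)).mp ?_
    rw [hsq, mul_pow _ (Real.exp _), ← Real.exp_nat_mul]
    gcongr
    have := Real.add_one_le_exp (-τ ^ 2)
    have h2 : ((2 : ℕ) : ℝ) * (-τ ^ 2 / 2) = -τ ^ 2 := by push_cast; ring
    rw [h2]
    linarith
  rw [norm_pow]
  refine (pow_le_pow_left₀ (norm_nonneg _) hb n).trans ?_
  rw [mul_pow, ← Real.exp_nat_mul, ← Real.exp_add]
  gcongr
  have h4 : (r * s / (1 + r ^ 2) * √(n + 1) *
      (Real.cos t - x * (r ^ 2 - 1) / (2 * r * s))) ^ 2 = (n + 1) * τ ^ 2 / 4 := by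
    rw [hτ, mul_pow, mul_pow, Real.sq_sqrt (by positivity)]
    field_simp
    ring
  have h5 : (0 : ℝ) ≤ n * τ ^ 2 := by positivity
  rw [h4]
  linarith

lemma sq_sub_le_abs_cos_sub_cos {a b : ℝ} (ha : a ∈ Icc 0 Real.pi) (hb : b ∈ Icc 0 Real.pi) :
    2 / Real.pi ^ 2 * (a - b) ^ 2 ≤ |Real.cos a - Real.cos b| := by
  wlog hab : b ≤ a generalizing a b
  · have := this hb ha (le_of_not_ge hab)
    rw [abs_sub_comm]
    linarith [show (a - b) ^ 2 = (b - a) ^ 2 by ring]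
  obtain ⟨ha0, ha1⟩ := ha
  obtain ⟨hb0, hb1⟩ := hb
  have hπ := Real.pi_pos
  have h1 : 2 / Real.pi * ((a - b) / 2) ≤ Real.sin ((a - b) / 2) :=
    Real.mul_le_sin (by linarith) (by linarith)
  have h2 : Real.sin ((a - b) / 2) ≤ Real.sin ((a + b) / 2) := by
    rcases le_total ((a + b) / 2) (Real.pi / 2) with h | h
    · exact Real.sin_le_sin_of_le_of_le_pi_div_two (by linarith) h (by linarith)
    · rw [← Real.sin_pi_sub ((a + b) / 2)]
      exact Real.sin_le_sin_of_le_of_le_pi_div_two (by linarith) (by linarith) (by linarith)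
  have h0 : 0 ≤ 2 / Real.pi * ((a - b) / 2) := mul_nonneg (by positivity) (by linarith)
  rw [Real.cos_sub_cos, abs_mul, abs_mul, abs_of_nonneg (h0.trans h1),
    abs_of_nonneg ((h0.trans h1).trans h2)]
  have h3 : (2 / Real.pi * ((a - b) / 2)) * (2 / Real.pi * ((a - b) / 2)) ≤
      Real.sin ((a + b) / 2) * Real.sin ((a - b) / 2) :=
    mul_le_mul (h1.trans h2) h1 h0 (h0.trans (h1.trans h2))
  have h4 : (2 / Real.pi * ((a - b) / 2)) * (2 / Real.pi * ((a - b) / 2)) * 2 =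
      2 / Real.pi ^ 2 * (a - b) ^ 2 := by field_simp
  norm_num
  linarith

lemma abs_cos_sub_cos_arccos_le {t : ℝ} (y : ℝ) :
    |Real.cos t - Real.cos (Real.arccos y)| ≤ |Real.cos t - y| := by
  have h1 := Real.cos_le_one t
  have h2 := Real.neg_one_le_cos t
  rcases le_total y (-1) with h | h
  · rw [Real.arccos_of_le_neg_one h, Real.cos_pi, abs_of_nonneg (by linarith),
      abs_of_nonneg (by linarith)]
    linarith
  rcases le_total 1 y with h' | h'
  · rw [Real.arccos_of_one_le h', Real.cos_zero, abs_of_nonpos (by linarith),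
      abs_of_nonpos (by linarith)]
    linarith
  · rw [Real.cos_arccos h h']

lemma exp_neg_sq_cos_sub_le {k : ℝ} (hk : 0 < k) (y : ℝ) {t : ℝ} (ht : t ∈ Icc 0 Real.pi) :
    Real.exp (-(k * (Real.cos t - y)) ^ 2) ≤
      Real.exp 1 * Real.exp (-(4 * k / Real.pi ^ 2) * (t - Real.arccos y) ^ 2) := by
  rw [← Real.exp_add]
  gcongr
  have h1 := (sq_sub_le_abs_cos_sub_cos ht ⟨Real.arccos_nonneg y, Real.arccos_le_pi y⟩).trans
    (abs_cos_sub_cos_arccos_le (t := t) y)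
  have h2 := mul_le_mul_of_nonneg_left h1 hk.le
  have h3 : (k * (Real.cos t - y)) ^ 2 = (k * |Real.cos t - y|) ^ 2 := by
    rw [mul_pow, mul_pow, sq_abs]
  have h4 : 4 * k / Real.pi ^ 2 * (t - Real.arccos y) ^ 2 =
      2 * (k * (2 / Real.pi ^ 2 * (t - Real.arccos y) ^ 2)) := by ring
  rw [h3]
  nlinarith [sq_nonneg (k * |Real.cos t - y| - 1)]

lemma integral_exp_neg_sq_cos_sub_le {k : ℝ} (hk : 0 < k) (y : ℝ) :
    ∫ t in (0 : ℝ)..2 * Real.pi, Real.exp (-(k * (Real.cos t - y)) ^ 2) ≤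
      Real.exp 1 * Real.pi * √(Real.pi / k) := by
  have hπ := Real.pi_pos
  set b : ℝ := 4 * k / Real.pi ^ 2 with hb
  have hb0 : 0 < b := by positivity
  set φ := Real.arccos y
  let G : ℝ → ℝ := fun t => Real.exp (-b * t ^ 2)
  have hG : Integrable G := integrable_exp_neg_mul_sq hb0
  have hG1 : Integrable fun t => G (t - φ) := hG.comp_sub_right φ
  have hG2 : Integrable fun t => G (2 * Real.pi - φ - t) := hG.comp_sub_left _
  have hI : ∫ t, G t = √(Real.pi / b) := integral_gaussian b
  have hH : Integrable fun t => Real.exp 1 * (G (t - φ) + G (2 * Real.pi - φ - t)) :=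
    (hG1.add hG2).const_mul _
  calc ∫ t in (0 : ℝ)..2 * Real.pi, Real.exp (-(k * (Real.cos t - y)) ^ 2)
      ≤ ∫ t in (0 : ℝ)..2 * Real.pi, Real.exp 1 * (G (t - φ) + G (2 * Real.pi - φ - t)) := by
        refine intervalIntegral.integral_mono_on (by positivity)
          (Continuous.intervalIntegrable (by fun_prop) _ _) hH.intervalIntegrable ?_
        rintro t ⟨h0, h1⟩
        rw [mul_add]
        rcases le_total t Real.pi with h | h
        · have := exp_neg_sq_cos_sub_le hk y (t := t) ⟨h0, h⟩
          have h' : 0 ≤ Real.exp 1 * G (2 * Real.pi - φ - t) := by positivity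
          linarith
        · have := exp_neg_sq_cos_sub_le hk y (t := 2 * Real.pi - t) ⟨by linarith, by linarith⟩
          rw [Real.cos_two_pi_sub, show 2 * Real.pi - t - Real.arccos y = 2 * Real.pi - φ - t by
            simp only [φ]; ring] at this
          have h' : 0 ≤ Real.exp 1 * G (t - φ) := by positivity
          linarith
    _ ≤ ∫ t, Real.exp 1 * (G (t - φ) + G (2 * Real.pi - φ - t)) := by
        rw [intervalIntegral.integral_of_le (by positivity)]
        exact setIntegral_le_integral hH (Filter.Eventually.of_forall fun t => by
          simp only [Pi.zero_apply]; positivity)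
    _ = Real.exp 1 * (2 * √(Real.pi / b)) := by
        rw [integral_const_mul, integral_add hG1 hG2, integral_sub_right_eq_self,
          integral_sub_left_eq_self, hI]
        ring
    _ = Real.exp 1 * Real.pi * √(Real.pi / k) := by
        have : Real.pi / b = (Real.pi / 2) ^ 2 * (Real.pi / k) := by
          rw [hb]; field_simp; norm_num
        rw [this, Real.sqrt_mul (by positivity), Real.sqrt_sq (by positivity)]
        ring

lemma abs_iteratedDeriv_sq_sub_one_pow_le {x s : ℝ} (hs0 : 0 < s) (hs : s ^ 2 = 1 - x ^ 2)
    {r : ℝ} (hr : 0 < r) (n N : ℕ) :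
    |iteratedDeriv N (fun y : ℝ => (y ^ 2 - 1) ^ n) x| ≤
      (N.factorial : ℝ) / (2 * Real.pi * (s * r) ^ N) * ((s * (1 + r ^ 2)) ^ n *
        (Real.exp 1 * (Real.exp 1 * Real.pi *
          √(Real.pi / (r * s / (1 + r ^ 2) * √(n + 1)))))) := by
  have hπ := Real.pi_pos
  have h1 := norm_iteratedDeriv_le_integral_circle (f := fun z : ℂ => (z ^ 2 - 1) ^ n)
    (by fun_prop) (x : ℂ) (mul_pos hs0 hr) N
  rw [← ofReal_iteratedDeriv_sq_sub_one_pow, Complex.norm_real, Real.norm_eq_abs] at h1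
  refine h1.trans ?_
  gcongr
  have hk : 0 < r * s / (1 + r ^ 2) * √((n : ℝ) + 1) := by positivity
  calc _ ≤ ∫ t in (0 : ℝ)..2 * Real.pi, (s * (1 + r ^ 2)) ^ n * (Real.exp 1 *
        Real.exp (-(r * s / (1 + r ^ 2) * √(n + 1) *
          (Real.cos t - x * (r ^ 2 - 1) / (2 * r * s))) ^ 2)) := by
        refine intervalIntegral.integral_mono_on (by positivity)
          (Continuous.intervalIntegrable (by fun_prop) _ _)
          (Continuous.intervalIntegrable (by fun_prop) _ _) fun t _ => ?_
        exact norm_circleMap_sq_sub_one_pow_le hs0 hs hr n t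
    _ ≤ _ := by
        rw [intervalIntegral.integral_const_mul, intervalIntegral.integral_const_mul]
        gcongr
        exact integral_exp_neg_sq_cos_sub_le hk _

lemma assocP_eq (n m : ℕ) (x : ℝ) :
    assocP n m x = (-1 : ℝ) ^ m * √(1 - x ^ 2) ^ m * (((2 : ℝ) ^ n * (n.factorial : ℝ))⁻¹ *
      iteratedDeriv (n + m) (fun y : ℝ => (y ^ 2 - 1) ^ n) x) := by
  have h : legendreP n = fun x => ((2 : ℝ) ^ n * (n.factorial : ℝ))⁻¹ *
      iteratedDeriv n (fun y => (y ^ 2 - 1) ^ n) x := rfl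
  have h2 : iteratedDeriv m (iteratedDeriv n (fun y : ℝ => (y ^ 2 - 1) ^ n)) =
      iteratedDeriv (n + m) (fun y : ℝ => (y ^ 2 - 1) ^ n) := by
    simp only [iteratedDeriv_eq_iterate, ← Function.iterate_add_apply, add_comm]
  rw [assocP, h, iteratedDeriv_const_mul_field, h2]

lemma assocP_sq_mul_le {x s : ℝ} (hs0 : 0 < s) (hs : s ^ 2 = 1 - x ^ 2)
    {r : ℝ} (hr : 0 < r) (n m : ℕ) :
    assocP n m x ^ 2 * s * √(n + 1) ≤ Real.exp 1 ^ 4 * Real.pi / 2 *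
      (((n + m).factorial : ℝ) ^ 2 / (n.factorial : ℝ) ^ 2 *
        (((1 + r ^ 2) / (2 * r)) ^ (2 * n + 1) * (r⁻¹) ^ (2 * m))) := by
  have hπ := Real.pi_pos
  have hs' : √(1 - x ^ 2) = s := by rw [← hs, Real.sqrt_sq hs0.le]
  have hN : (0 : ℝ) < √((n : ℝ) + 1) := by positivity
  set w := √((n : ℝ) + 1)
  have hD := abs_iteratedDeriv_sq_sub_one_pow_le hs0 hs hr n (n + m)
  have hD2 := pow_le_pow_left₀ (abs_nonneg _) hD 2
  have hS : √(Real.pi / (r * s / (1 + r ^ 2) * w)) ^ 2 = Real.pi / (r * s / (1 + r ^ 2) * w) :=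
    Real.sq_sqrt (by positivity)
  simp only [sq_abs, mul_pow _ _ 2] at hD2
  rw [hS] at hD2
  rw [assocP_eq, hs']
  have e1 : ((-1 : ℝ) ^ m) ^ 2 = 1 := by rw [← pow_mul, mul_comm, pow_mul]; simp
  simp only [mul_pow _ _ 2, e1, one_mul]
  refine (mul_le_mul_of_nonneg_right (mul_le_mul_of_nonneg_right (mul_le_mul_of_nonneg_left
    (mul_le_mul_of_nonneg_left hD2 (by positivity)) (by positivity)) hs0.le) hN.le).trans
    (le_of_eq ?_)
  have hr1 : 0 < 1 + r ^ 2 := by positivity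
  rw [mul_pow s (1 + r ^ 2) n, div_pow _ (2 * r), mul_pow 2 r, inv_pow r]
  generalize 1 + r ^ 2 = c at hr1
  field_simp
  ring

lemma factorial_add_one_eq (k : ℕ) : (k.factorial : ℝ) =
    √2 * Stirling.stirlingSeq (k + 1) * ((k + 1 : ℝ) ^ k * √(k + 1) * Real.exp (-(k + 1))) := by
  have h : ((k + 1).factorial : ℝ) = (k + 1) * k.factorial := by
    rw [Nat.factorial_succ]; push_cast; ring
  have hs : √((k : ℝ) + 1) * √((k : ℝ) + 1) = k + 1 := Real.mul_self_sqrt (by positivity)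
  rw [Stirling.stirlingSeq, h, div_pow, ← Real.exp_nat_mul, Real.sqrt_mul (by norm_num),
    Real.exp_neg]
  push_cast
  rw [mul_one]
  field_simp
  rw [pow_succ]
  nlinarith [hs]

lemma factorial_le_stirling (k : ℕ) :
    (k.factorial : ℝ) ≤ Real.exp 1 * ((k + 1 : ℝ) ^ k * √(k + 1) * Real.exp (-(k + 1))) := by
  rw [factorial_add_one_eq]
  gcongr
  have h := Stirling.stirlingSeq'_antitone (Nat.zero_le k)
  simp only [Function.comp, Nat.succ_eq_add_one, zero_add, Stirling.stirlingSeq_one] at h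
  calc √2 * Stirling.stirlingSeq (k + 1) ≤ √2 * (Real.exp 1 / √2) := by gcongr
    _ = Real.exp 1 := by field_simp

lemma stirling_le_factorial (k : ℕ) :
    (k + 1 : ℝ) ^ k * √(k + 1) * Real.exp (-(k + 1)) ≤ k.factorial := by
  rw [factorial_add_one_eq]
  refine le_mul_of_one_le_left (by positivity) ?_
  have h := Stirling.sqrt_pi_le_stirlingSeq (Nat.succ_ne_zero k)
  have h1 : 1 ≤ √Real.pi := Real.one_le_sqrt.mpr (by linarith [Real.pi_gt_three])
  have h2 : 1 ≤ √(2 : ℝ) := Real.one_le_sqrt.mpr (by norm_num)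
  have h3 : 1 ≤ Stirling.stirlingSeq (k + 1) := h1.trans h
  nlinarith

lemma factorial_mul_factorial_le (q m : ℕ) {r : ℝ} (hr : 0 < r)
    (hr2 : r ^ 2 = (q + 2 * m + 1) / (q + 1)) :
    ((q + 2 * m).factorial : ℝ) * q.factorial *
      (((1 + r ^ 2) / (2 * r)) ^ (2 * (q + m) + 1) * (r⁻¹) ^ (2 * m)) ≤
      Real.exp 1 ^ 2 * ((q + m).factorial : ℝ) ^ 2 := by
  have hp := factorial_le_stirling (q + 2 * m)
  have hq := factorial_le_stirling q
  have hn := stirling_le_factorial (q + m)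
  push_cast at hp hn
  set a : ℝ := q + 2 * m + 1 with ha
  set b : ℝ := q + 1 with hb
  have ha0 : 0 < a := by positivity
  have hb0 : 0 < b := by positivity
  have hab : (q : ℝ) + m + 1 = (a + b) / 2 := by rw [ha, hb]; ring
  have hA : 0 < √a := by positivity
  have hB : 0 < √b := by positivity
  have hA2 : √a ^ 2 = a := Real.sq_sqrt ha0.le
  have hB2 : √b ^ 2 = b := Real.sq_sqrt hb0.le
  have hrr : r = √a / √b := by
    rw [← Real.sqrt_div ha0.le, ← hr2, Real.sqrt_sq hr.le]
  have hh : (1 + r ^ 2) / (2 * r) = ((a + b) / 2) / (√a * √b) := by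
    rw [hrr, div_pow, hA2, hB2]
    field_simp
    rw [hB2]
    ring
  have hn2 := pow_le_pow_left₀ (by positivity) hn 2
  have hexp : Real.exp (-a) * Real.exp (-b) = Real.exp (-((q : ℝ) + m + 1)) ^ 2 := by
    rw [← Real.exp_add, ← Real.exp_nat_mul, hab]
    congr 1
    push_cast
    ring
  calc _ ≤ (Real.exp 1 * (a ^ (q + 2 * m) * √a * Real.exp (-a))) *
        (Real.exp 1 * (b ^ q * √b * Real.exp (-b))) *
        (((1 + r ^ 2) / (2 * r)) ^ (2 * (q + m) + 1) * (r⁻¹) ^ (2 * m)) := by gcongr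
    _ = Real.exp 1 ^ 2 * (((q : ℝ) + m + 1) ^ (q + m) * √(q + m + 1) *
        Real.exp (-((q : ℝ) + m + 1))) ^ 2 := by
        rw [mul_pow _ (Real.exp _), ← hexp, mul_pow, Real.sq_sqrt (by positivity), hab, hh, hrr,
          inv_div]
        have e1 : a ^ (q + 2 * m) = √a ^ (2 * (q + 2 * m)) := by rw [pow_mul, hA2]
        have e2 : b ^ q = √b ^ (2 * q) := by rw [pow_mul, hB2]
        rw [e1, e2]
        generalize (a + b) / 2 = c
        rw [div_pow, div_pow, mul_pow]
        field_simp
        ring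
    _ ≤ _ := by gcongr

lemma tY_sq (n : ℕ) (m : ℤ) (h : m.natAbs ≤ n) (x : ℝ) :
    tY n m x ^ 2 = (2 * (n : ℝ) + 1) / (4 * Real.pi) *
      (((n - m.natAbs).factorial : ℝ) / ((n + m.natAbs).factorial : ℝ)) *
      assocP n m.natAbs x ^ 2 := by
  have hπ := Real.pi_pos
  rw [tY, mul_pow, Real.sq_sqrt (by positivity), assocPZ]
  split_ifs with hm
  · rw [show ((n : ℤ) - m).toNat = n - m.natAbs by omega,
      show ((n : ℤ) + m).toNat = n + m.natAbs by omega, show m.toNat = m.natAbs by omega]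
  · rw [show ((n : ℤ) - m).toNat = n + m.natAbs by omega,
      show ((n : ℤ) + m).toNat = n - m.natAbs by omega]
    have e1 : ((-1 : ℝ) ^ m.natAbs) ^ 2 = 1 := by rw [← pow_mul, mul_comm, pow_mul]; simp
    rw [mul_pow, mul_pow, e1]
    field_simp

lemma tY_sq_mul_le (n : ℕ) (m : ℤ) (h : m.natAbs ≤ n) {x s : ℝ} (hs0 : 0 < s)
    (hs : s ^ 2 = 1 - x ^ 2) : tY n m x ^ 2 * s ≤ Real.exp 1 ^ 6 * √(1 + n) := by
  have hπ := Real.pi_pos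
  rw [tY_sq n m h]
  generalize m.natAbs = μ at h
  obtain ⟨q, rfl⟩ := Nat.exists_eq_add_of_le' h
  set r : ℝ := √((q + 2 * μ + 1) / (q + 1)) with hr
  have hr0 : 0 < r := by positivity
  have hr2 : r ^ 2 = (q + 2 * μ + 1) / (q + 1) := Real.sq_sqrt (by positivity)
  have h1 := assocP_sq_mul_le hs0 hs hr0 (q + μ) μ
  have h2 := factorial_mul_factorial_le q μ hr0 hr2
  rw [Nat.add_sub_cancel, show q + μ + μ = q + 2 * μ by ring] at *
  rw [add_comm 1]
  set w := √(((q + μ : ℕ) : ℝ) + 1) with hw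
  have hw0 : 0 < w := by positivity
  have hw2 : w ^ 2 = ((q + μ : ℕ) : ℝ) + 1 := Real.sq_sqrt (by positivity)
  have hn0 : (0 : ℝ) ≤ ((q + μ : ℕ) : ℝ) := by positivity
  generalize ((q + μ : ℕ) : ℝ) = ν at *
  generalize ((1 + r ^ 2) / (2 * r)) ^ (2 * (q + μ) + 1) * (r⁻¹) ^ (2 * μ) = H at *
  have hp0 : (0 : ℝ) < (q + 2 * μ).factorial := by positivity
  have hq0 : (0 : ℝ) < q.factorial := by positivity
  have hf0 : (0 : ℝ) < (q + μ).factorial := by positivity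
  generalize ((q + 2 * μ).factorial : ℝ) = p at *
  generalize (q.factorial : ℝ) = d at *
  generalize ((q + μ).factorial : ℝ) = f at *
  generalize assocP (q + μ) μ x = P at *
  have h3 : d / p * (P ^ 2 * s * w) ≤ Real.exp 1 ^ 6 * Real.pi / 2 := by
    calc d / p * (P ^ 2 * s * w)
        ≤ d / p * (Real.exp 1 ^ 4 * Real.pi / 2 * (p ^ 2 / f ^ 2 * H)) := by gcongr
      _ = Real.exp 1 ^ 4 * Real.pi / 2 / f ^ 2 * (p * d * H) := by field_simp
      _ ≤ Real.exp 1 ^ 4 * Real.pi / 2 / f ^ 2 * (Real.exp 1 ^ 2 * f ^ 2) := by gcongr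
      _ = Real.exp 1 ^ 6 * Real.pi / 2 := by field_simp
  refine le_of_mul_le_mul_right ?_ hw0
  calc _ = (2 * ν + 1) / (4 * Real.pi) * (d / p * (P ^ 2 * s * w)) := by ring
    _ ≤ (4 * w ^ 2) / (4 * Real.pi) * (Real.exp 1 ^ 6 * Real.pi / 2) := by
        gcongr
        linarith
    _ = Real.exp 1 ^ 6 * w ^ 2 / 2 := by field_simp
    _ ≤ _ := by nlinarith [show 0 ≤ Real.exp 1 ^ 6 * w ^ 2 by positivity]

/-- the uniform bound `|Ỹ_{ℓ,m}(x)| (1−x²)^{1/4} ≤ C (1+ℓ)^{1/4}`. -/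
theorem statement8 :
    ∃ C : ℝ, 0 < C ∧ ∀ (n : ℕ) (m : ℤ), m.natAbs ≤ n → ∀ x : ℝ, x ∈ Set.Icc (-1 : ℝ) 1 →
      |tY n m x| * (1 - x^2) ^ ((1:ℝ)/4) ≤ C * (1 + (n:ℝ)) ^ ((1:ℝ)/4) := by
  refine ⟨Real.exp 1 ^ 3, by positivity, fun n m hm x hx => ?_⟩
  have hx2 : 0 ≤ 1 - x ^ 2 := by nlinarith [hx.1, hx.2]
  have hroot {a : ℝ} (ha : 0 ≤ a) : (a ^ ((1 : ℝ) / 4)) ^ 2 = √a := by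
    rw [← Real.rpow_natCast, ← Real.rpow_mul ha, Real.sqrt_eq_rpow]
    norm_num
  rcases hx2.eq_or_lt with h0 | h0
  · rw [← h0, Real.zero_rpow (by norm_num), mul_zero]
    positivity
  · refine (sq_le_sq₀ (by positivity) (by positivity)).mp ?_
    rw [mul_pow, mul_pow, hroot hx2, hroot (by positivity), sq_abs]
    refine (tY_sq_mul_le n m hm (Real.sqrt_pos.mpr h0) (Real.sq_sqrt hx2)).trans (le_of_eq ?_)
    ring
end
end
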